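/- arXiv:0801.0920 — 5 statements merged into one kernel-verified Lean document; each statement's English description precedes it below -/
import Mathlib

section
/- Let O be the valuation ring of a finite unramified extension of ℚ_ℓ of degree d over ℤ_ℓ, Λ_O = O[[T]], and f ∈ O[T] a distinguished polynomial of degree e. Set X = Λ_O/fΛ_O and ∇_n = ℓ^{n+1}Λ_O + ω_nΛ_O with ω_n = (1+T)^{ℓ^n} − 1. Then for all sufficiently large n, ∇_{n+1}X = ℓ∇_nX, and consequently the index (X : ∇_nX) equals ℓ^{d·e·n + c} for some constant integer c and all large n. -/
/-- A distinguished polynomial over `O`: monic, with all lower coefficients divisible by `ℓ`. -/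
def IsDistinguishedAt {O : Type*} [CommRing O] (ℓ : ℕ) (f : Polynomial O) : Prop :=
  f.Monic ∧ ∀ i < f.natDegree, f.coeff i ∈ Ideal.span {(ℓ : O)}

/-- `ω_n = (1+T)^(ℓ^n) - 1` in `Λ_O = O[[T]]`. -/
noncomputable def omegaO (O : Type*) [CommRing O] (ℓ n : ℕ) : PowerSeries O :=
  (1 + PowerSeries.X) ^ (ℓ ^ n) - 1

/-- `∇_n = ℓ^(n+1)Λ_O + ω_nΛ_O`. -/
noncomputable def nablaO (O : Type*) [CommRing O] (ℓ n : ℕ) : Ideal (PowerSeries O) :=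
  Ideal.span {(ℓ : PowerSeries O) ^ (n + 1), omegaO O ℓ n}

namespace NablaAux

open PowerSeries

variable {O : Type*} [CommRing O]

theorem exists_series (ℓ : ℕ) (f : Polynomial O) (hf : IsDistinguishedAt ℓ f) :
    ∃ g : PowerSeries O,
      (f : PowerSeries O) = PowerSeries.X ^ f.natDegree + (ℓ : PowerSeries O) * g := by
  have h : Polynomial.C (ℓ : O) ∣ f - Polynomial.X ^ f.natDegree := by
    rw [Polynomial.C_dvd_iff_dvd_coeff]
    intro i
    rw [Polynomial.coeff_sub, Polynomial.coeff_X_pow]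
    rcases lt_trichotomy i f.natDegree with h | h | h
    · rw [if_neg h.ne, sub_zero]
      exact Ideal.mem_span_singleton.1 (hf.2 i h)
    · subst h
      rw [if_pos rfl, show f.coeff f.natDegree = 1 from hf.1]
      simp
    · rw [if_neg h.ne', Polynomial.coeff_eq_zero_of_natDegree_lt h]
      simp
  obtain ⟨g, hg⟩ := h
  refine ⟨(g : PowerSeries O), ?_⟩
  have h2 : f = Polynomial.X ^ f.natDegree + Polynomial.C (ℓ : O) * g := by
    rw [← hg]; ring
  have h3 := congrArg (fun p : Polynomial O => (p : PowerSeries O)) h2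
  simpa only [Polynomial.coe_add, Polynomial.coe_mul, Polynomial.coe_pow, Polynomial.coe_X,
    Polynomial.coe_C, map_natCast PowerSeries.C] using h3

theorem dvd_series_iff (a : ℕ) (s : PowerSeries O) :
    (a : PowerSeries O) ∣ s ↔ ∀ i, (a : O) ∣ PowerSeries.coeff i s := by
  have key : (a : PowerSeries O) = PowerSeries.C (a : O) := by simp
  rw [key]
  constructor
  · rintro ⟨t, rfl⟩ i
    rw [PowerSeries.coeff_C_mul]
    exact dvd_mul_right _ _
  · intro h
    choose c hc using h
    refine ⟨PowerSeries.mk c, ?_⟩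
    ext i
    rw [PowerSeries.coeff_C_mul, PowerSeries.coeff_mk, hc]

theorem isUnit_one_add (ℓ : ℕ) (hmax : (Ideal.span {(ℓ : O)}).IsMaximal)
    (huniq : ∀ M : Ideal O, M.IsMaximal → M = Ideal.span {(ℓ : O)})
    (s : PowerSeries O) : IsUnit (1 + (ℓ : PowerSeries O) * s) := by
  rw [PowerSeries.isUnit_iff_constantCoeff]
  by_contra h
  obtain ⟨M, hM, hmem⟩ := exists_max_ideal_of_mem_nonunits h
  rw [huniq M hM] at hmem
  apply hmax.ne_top
  rw [Ideal.eq_top_iff_one]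
  have : (1 : O) = PowerSeries.constantCoeff (1 + (ℓ : PowerSeries O) * s)
      - (ℓ : O) * PowerSeries.constantCoeff s := by simp
  rw [this]
  exact Ideal.sub_mem _ hmem (Ideal.mul_mem_right _ _ (Ideal.mem_span_singleton_self _))

theorem regular (ℓ : ℕ) [IsDomain O] (h0 : (ℓ : O) ≠ 0)
    (f : Polynomial O) (hf : IsDistinguishedAt ℓ f)
    (x : PowerSeries O ⧸ Ideal.span {(f : PowerSeries O)})
    (hx : (ℓ : PowerSeries O) • x = 0) : x = 0 := by
  obtain ⟨a, rfl⟩ := Ideal.Quotient.mk_surjective x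
  obtain ⟨g, hg⟩ := exists_series ℓ f hf
  have h1 : (ℓ : PowerSeries O) * a ∈ Ideal.span {(f : PowerSeries O)} := by
    rw [← Ideal.Quotient.eq_zero_iff_mem]
    exact hx
  obtain ⟨b, hb⟩ := Ideal.mem_span_singleton.1 h1
  have h2 : (ℓ : PowerSeries O) ∣ PowerSeries.X ^ f.natDegree * b := by
    refine ⟨a - g * b, ?_⟩
    rw [hg] at hb
    linear_combination -hb
  have h3 : (ℓ : PowerSeries O) ∣ b := by
    rw [dvd_series_iff] at h2 ⊢
    intro i
    have := h2 (i + f.natDegree)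
    rwa [PowerSeries.coeff_X_pow_mul] at this
  obtain ⟨c, rfl⟩ := h3
  have hne : (ℓ : PowerSeries O) ≠ 0 := by
    intro h
    apply h0
    have := congrArg (PowerSeries.constantCoeff) h
    simpa using this
  have h4 : a = f * c := by
    apply mul_left_cancel₀ hne
    rw [hb]; ring
  rw [Ideal.Quotient.eq_zero_iff_mem, h4]
  exact Ideal.mul_mem_right _ _ (Ideal.mem_span_singleton_self _)

/-- abstract iteration -/
theorem pow_step {A : Type*} [CommRing A] (ℓ : ℕ) (a : A) (n : ℕ) :
    ∃ k : A, a ^ ℓ ^ (n + 1) - 1 =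
      ℓ * (a ^ ℓ ^ n - 1) + k * (a ^ ℓ ^ n - 1) ^ 2 := by
  obtain ⟨k, hk⟩ := Polynomial.powAddExpansion (1 : A) (a ^ ℓ ^ n - 1) ℓ
  refine ⟨k, ?_⟩
  rw [show (1 : A) + (a ^ ℓ ^ n - 1) = a ^ ℓ ^ n by ring, ← pow_mul, ← pow_succ] at hk
  rw [hk]; simp only [one_pow]; ring

theorem sq_dvd (ℓ : ℕ) [hp : Fact ℓ.Prime] (f : Polynomial O) (hf : IsDistinguishedAt ℓ f)
    (n : ℕ) (hn : f.natDegree + 1 ≤ n) :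
    ∃ v, Ideal.Quotient.mk (Ideal.span {(f : PowerSeries O)}) (omegaO O ℓ n) =
      (ℓ : PowerSeries O ⧸ Ideal.span {(f : PowerSeries O)}) ^ 2 * v := by
  obtain ⟨g, hg⟩ := exists_series ℓ f hf
  have homega : ∀ n, Ideal.Quotient.mk (Ideal.span {(f : PowerSeries O)}) (omegaO O ℓ n) =
      (Ideal.Quotient.mk (Ideal.span {(f : PowerSeries O)}) (1 + PowerSeries.X)) ^ ℓ ^ n - 1 := by
    intro n
    simp [omegaO]
  induction n, hn using Nat.le_induction with
  | base =>
    have h1 : ∃ v, Ideal.Quotient.mk (Ideal.span {(f : PowerSeries O)})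
        (omegaO O ℓ f.natDegree) =
        (ℓ : PowerSeries O ⧸ Ideal.span {(f : PowerSeries O)}) * v := by
      obtain ⟨r, hr⟩ := exists_add_pow_prime_pow_eq hp.out (1 : PowerSeries O)
        PowerSeries.X f.natDegree
      obtain ⟨m, hm⟩ := Nat.exists_eq_add_of_le (Nat.lt_pow_self hp.out.one_lt :
        f.natDegree < ℓ ^ f.natDegree).le
      have hX : (Ideal.Quotient.mk (Ideal.span {(f : PowerSeries O)})) PowerSeries.X ^ f.natDegree
          = - ((ℓ : PowerSeries O ⧸ Ideal.span {(f : PowerSeries O)}) *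
            Ideal.Quotient.mk (Ideal.span {(f : PowerSeries O)}) g) := by
        have : Ideal.Quotient.mk (Ideal.span {(f : PowerSeries O)}) (f : PowerSeries O) = 0 :=
          Ideal.Quotient.eq_zero_iff_mem.2 (Ideal.mem_span_singleton_self _)
        have h5 := congrArg (Ideal.Quotient.mk (Ideal.span {(f : PowerSeries O)})) hg
        rw [this] at h5
        simp only [map_add, map_mul, map_pow, map_natCast] at h5
        linear_combination -h5
      have h6 : omegaO O ℓ f.natDegree = PowerSeries.X ^ f.natDegree * PowerSeries.X ^ m
          + (ℓ : PowerSeries O) * (PowerSeries.X * r) := by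
        rw [omegaO, hr, ← pow_add, ← hm]; ring
      rw [h6]
      simp only [map_add, map_mul, map_pow, map_natCast, hX]
      exact ⟨- Ideal.Quotient.mk _ g * Ideal.Quotient.mk _ PowerSeries.X ^ m
        + Ideal.Quotient.mk _ PowerSeries.X * Ideal.Quotient.mk _ r, by ring⟩
    obtain ⟨v, hv⟩ := h1
    obtain ⟨k, hk⟩ := pow_step ℓ
      (Ideal.Quotient.mk (Ideal.span {(f : PowerSeries O)}) (1 + PowerSeries.X)) f.natDegree
    rw [← homega, ← homega, hv] at hk
    exact ⟨v + k * v ^ 2, by rw [hk]; ring⟩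
  | succ n hn ih =>
    obtain ⟨v, hv⟩ := ih
    obtain ⟨k, hk⟩ := pow_step ℓ
      (Ideal.Quotient.mk (Ideal.span {(f : PowerSeries O)}) (1 + PowerSeries.X)) n
    rw [← homega, ← homega, hv] at hk
    exact ⟨ℓ * v + k * ℓ ^ 2 * v ^ 2, by rw [hk]; ring⟩

theorem omega_succ (ℓ : ℕ) [hp : Fact ℓ.Prime] (f : Polynomial O) (hf : IsDistinguishedAt ℓ f)
    (hmax : (Ideal.span {(ℓ : O)}).IsMaximal)
    (huniq : ∀ M : Ideal O, M.IsMaximal → M = Ideal.span {(ℓ : O)})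
    (n : ℕ) (hn : f.natDegree + 1 ≤ n) :
    ∃ u : (PowerSeries O)ˣ,
      Ideal.Quotient.mk (Ideal.span {(f : PowerSeries O)}) (omegaO O ℓ (n + 1)) =
      Ideal.Quotient.mk (Ideal.span {(f : PowerSeries O)}) (u * (ℓ * omegaO O ℓ n)) := by
  obtain ⟨v, hv⟩ := sq_dvd ℓ f hf n hn
  obtain ⟨v, rfl⟩ := Ideal.Quotient.mk_surjective v
  obtain ⟨k, hk⟩ := pow_step ℓ (1 + PowerSeries.X : PowerSeries O) n
  obtain ⟨u, hu⟩ := isUnit_one_add ℓ hmax huniq (k * v)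
  refine ⟨u, ?_⟩
  rw [hu]
  have hk2 : omegaO O ℓ (n + 1) = ℓ * omegaO O ℓ n + k * omegaO O ℓ n * omegaO O ℓ n := by
    rw [omegaO, hk, omegaO]; ring
  rw [hk2]
  simp only [map_add, map_mul, map_natCast, map_one]
  linear_combination (Ideal.Quotient.mk _ k * Ideal.Quotient.mk _ (omegaO O ℓ n)) * hv

theorem smul_top_eq (F I : Ideal (PowerSeries O)) :
    I • (⊤ : Submodule (PowerSeries O) (PowerSeries O ⧸ F)) = Submodule.map F.mkQ I := by
  have : (⊤ : Submodule (PowerSeries O) (PowerSeries O ⧸ F)) = Submodule.map F.mkQ ⊤ := by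
    rw [Submodule.map_top, Submodule.range_mkQ]
  rw [this, ← Submodule.map_smul'']
  congr 1
  simp

theorem nabla_succ (ℓ : ℕ) [hp : Fact ℓ.Prime] (f : Polynomial O) (hf : IsDistinguishedAt ℓ f)
    (hmax : (Ideal.span {(ℓ : O)}).IsMaximal)
    (huniq : ∀ M : Ideal O, M.IsMaximal → M = Ideal.span {(ℓ : O)})
    (n : ℕ) (hn : f.natDegree + 1 ≤ n) :
    nablaO O ℓ (n + 1) • (⊤ : Submodule (PowerSeries O)
            (PowerSeries O ⧸ Ideal.span {(f : PowerSeries O)})) =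
          Ideal.span {(ℓ : PowerSeries O)} •
            (nablaO O ℓ n • (⊤ : Submodule (PowerSeries O)
              (PowerSeries O ⧸ Ideal.span {(f : PowerSeries O)}))) := by
  obtain ⟨u, hu⟩ := omega_succ ℓ f hf hmax huniq n hn
  rw [smul_top_eq, smul_top_eq, ← Submodule.map_smul'', smul_eq_mul, nablaO, nablaO,
    Ideal.span_mul_span', Set.singleton_mul, Set.image_pair]
  unfold Ideal.span
  rw [Submodule.map_span, Submodule.map_span, Set.image_pair, Set.image_pair, ← pow_succ']
  have hu2 : (Ideal.span {(f : PowerSeries O)}).mkQ (omegaO O ℓ (n + 1)) =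
      (u : PowerSeries O) • (Ideal.span {(f : PowerSeries O)}).mkQ (ℓ * omegaO O ℓ n) := hu
  have hu3 : (Ideal.span {(f : PowerSeries O)}).mkQ (ℓ * omegaO O ℓ n) =
      ((u⁻¹ : (PowerSeries O)ˣ) : PowerSeries O) •
        (Ideal.span {(f : PowerSeries O)}).mkQ (omegaO O ℓ (n + 1)) := by
    rw [hu2, smul_smul, Units.inv_mul, one_smul]
  apply le_antisymm
  · rw [Submodule.span_le]
    rintro x (rfl | rfl)
    · exact Submodule.subset_span (Or.inl rfl)
    · refine SetLike.mem_coe.2 ?_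
      refine hu2 ▸ Submodule.smul_mem _ _ (Submodule.subset_span (Or.inr rfl))
  · rw [Submodule.span_le]
    rintro x (rfl | rfl)
    · exact Submodule.subset_span (Or.inl rfl)
    · refine SetLike.mem_coe.2 ?_
      refine hu3 ▸ Submodule.smul_mem _ _ (Submodule.subset_span (Or.inr rfl))

theorem card_smul {R M : Type*} [CommRing R] [AddCommGroup M] [Module R M] (r : R)
    (hr : ∀ x : M, r • x = 0 → x = 0) (N : Submodule R M) :
    Nat.card (M ⧸ (Ideal.span {r} • N)) =
      Nat.card (M ⧸ N) * Nat.card (M ⧸ (Ideal.span {r} • (⊤ : Submodule R M))) := by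
  have h := AddSubgroup.index_map_of_injective N.toAddSubgroup
    (f := (LinearMap.lsmul R M r).toAddMonoidHom)
    ((injective_iff_map_eq_zero _).2 hr)
  have e1 : AddSubgroup.map (LinearMap.lsmul R M r).toAddMonoidHom N.toAddSubgroup
      = (Ideal.span {r} • N).toAddSubgroup := by
    ext x
    rw [Submodule.ideal_span_singleton_smul]
    simp [← SetLike.mem_coe, Set.mem_smul_set]
  have e2 : (LinearMap.lsmul R M r).toAddMonoidHom.range
      = (Ideal.span {r} • (⊤ : Submodule R M)).toAddSubgroup := by
    ext x
    rw [Submodule.ideal_span_singleton_smul]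
    simp [← SetLike.mem_coe, Set.mem_smul_set]
  rw [e1, e2] at h
  exact h

/-- coordinates of `O` modulo `ℓ` -/
noncomputable def coordHom (ℓ : ℕ) [hp : Fact ℓ.Prime] (O : Type*) [CommRing O] [Algebra ℤ_[ℓ] O]
    [Module.Finite ℤ_[ℓ] O] [Module.Free ℤ_[ℓ] O] :
    O →+ (Fin (Module.finrank ℤ_[ℓ] O) → ZMod ℓ) where
  toFun x := fun i => PadicInt.toZMod ((Module.finBasis ℤ_[ℓ] O).repr x i)
  map_zero' := by ext; simp
  map_add' x y := by ext; simp

theorem coordHom_eq_zero (ℓ : ℕ) [hp : Fact ℓ.Prime] [Algebra ℤ_[ℓ] O]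
    [Module.Finite ℤ_[ℓ] O] [Module.Free ℤ_[ℓ] O] (x : O) :
    coordHom ℓ O x = 0 ↔ (ℓ : O) ∣ x := by
  have hz : ∀ z : ℤ_[ℓ], PadicInt.toZMod z = 0 ↔ (ℓ : ℤ_[ℓ]) ∣ z := by
    intro z
    rw [← RingHom.mem_ker, PadicInt.ker_toZMod, PadicInt.maximalIdeal_eq_span_p,
      Ideal.mem_span_singleton]
  have h1 : coordHom ℓ O x = 0 ↔ ∀ i, (ℓ : ℤ_[ℓ]) ∣ (Module.finBasis ℤ_[ℓ] O).repr x i := by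
    rw [funext_iff]
    exact forall_congr' fun i => hz _
  have hs : ∀ y : O, (ℓ : O) * y = (ℓ : ℤ_[ℓ]) • y := by
    intro y
    rw [Algebra.smul_def, map_natCast]
  rw [h1]
  constructor
  · intro h
    choose c hc using h
    refine ⟨∑ i, c i • Module.finBasis ℤ_[ℓ] O i, ?_⟩
    rw [hs, Finset.smul_sum]
    conv_lhs => rw [← (Module.finBasis ℤ_[ℓ] O).sum_repr x]
    refine Finset.sum_congr rfl fun i _ => ?_
    rw [hc, smul_smul]
  · rintro ⟨y, rfl⟩ i
    rw [hs]
    simp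

theorem coordHom_surjective (ℓ : ℕ) [hp : Fact ℓ.Prime] [Algebra ℤ_[ℓ] O]
    [Module.Finite ℤ_[ℓ] O] [Module.Free ℤ_[ℓ] O] :
    Function.Surjective (coordHom ℓ O) := by
  intro y
  choose z hz using fun i => ZMod.ringHom_surjective (PadicInt.toZMod (p := ℓ)) (y i)
  refine ⟨(Module.finBasis ℤ_[ℓ] O).equivFun.symm z, ?_⟩
  ext i
  change PadicInt.toZMod ((Module.finBasis ℤ_[ℓ] O).equivFun
    ((Module.finBasis ℤ_[ℓ] O).equivFun.symm z) i) = y i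
  rw [LinearEquiv.apply_symm_apply, hz]

/-- the first `e` coefficients modulo `ℓ` -/
noncomputable def bigHom (ℓ e : ℕ) [hp : Fact ℓ.Prime] (O : Type*) [CommRing O] [Algebra ℤ_[ℓ] O]
    [Module.Finite ℤ_[ℓ] O] [Module.Free ℤ_[ℓ] O] :
    PowerSeries O →+ (Fin e → Fin (Module.finrank ℤ_[ℓ] O) → ZMod ℓ) where
  toFun s := fun i => coordHom ℓ O (PowerSeries.coeff (i : ℕ) s)
  map_zero' := by ext; simp
  map_add' x y := by ext; simp

theorem bigHom_surjective (ℓ e : ℕ) [hp : Fact ℓ.Prime] [Algebra ℤ_[ℓ] O]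
    [Module.Finite ℤ_[ℓ] O] [Module.Free ℤ_[ℓ] O] :
    Function.Surjective (bigHom ℓ e O) := by
  intro y
  choose z hz using fun i => coordHom_surjective (O := O) ℓ (y i)
  refine ⟨PowerSeries.mk fun i => if h : i < e then z ⟨i, h⟩ else 0, ?_⟩
  funext i
  change coordHom ℓ O (PowerSeries.coeff (i : ℕ) _) = y i
  rw [PowerSeries.coeff_mk, dif_pos i.2, hz]

theorem bigHom_eq_zero (ℓ : ℕ) [hp : Fact ℓ.Prime] [Algebra ℤ_[ℓ] O]
    [Module.Finite ℤ_[ℓ] O] [Module.Free ℤ_[ℓ] O]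
    (f : Polynomial O) (hf : IsDistinguishedAt ℓ f) (s : PowerSeries O) :
    bigHom ℓ f.natDegree O s = 0 ↔ ∃ t b : PowerSeries O, s = ℓ * t + f * b := by
  obtain ⟨g, hg⟩ := exists_series ℓ f hf
  have h1 : bigHom ℓ f.natDegree O s = 0 ↔
      ∀ i < f.natDegree, (ℓ : O) ∣ PowerSeries.coeff i s := by
    rw [funext_iff]
    constructor
    · intro h i hi
      exact (coordHom_eq_zero ℓ _).1 (h ⟨i, hi⟩)
    · intro h i
      exact (coordHom_eq_zero ℓ _).2 (h i i.2)
  rw [h1]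
  constructor
  · intro h
    have h2 : (ℓ : PowerSeries O) ∣ s - PowerSeries.X ^ f.natDegree *
        PowerSeries.mk (fun i => PowerSeries.coeff (i + f.natDegree) s) := by
      rw [dvd_series_iff]
      intro i
      rw [map_sub, PowerSeries.coeff_X_pow_mul']
      split_ifs with hi
      · rw [PowerSeries.coeff_mk, Nat.sub_add_cancel hi, sub_self]
        exact dvd_zero _
      · rw [sub_zero]
        exact h i (not_le.1 hi)
    obtain ⟨t, ht⟩ := h2
    set b := PowerSeries.mk (fun i => PowerSeries.coeff (i + f.natDegree) s)
    refine ⟨t - g * b, b, ?_⟩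
    rw [hg]
    linear_combination ht
  · rintro ⟨t, b, rfl⟩ i hi
    have h3 : (ℓ : PowerSeries O) * t + (f : PowerSeries O) * b =
        PowerSeries.X ^ f.natDegree * b + (ℓ : PowerSeries O) * (t + g * b) := by
      rw [hg]; ring
    rw [h3, map_add, PowerSeries.coeff_X_pow_mul', if_neg (not_le.2 hi), zero_add]
    exact (dvd_series_iff ℓ _).1 (dvd_mul_right _ _) i

theorem card_mod (ℓ : ℕ) [hp : Fact ℓ.Prime] [Algebra ℤ_[ℓ] O]
    [Module.Finite ℤ_[ℓ] O] [Module.Free ℤ_[ℓ] O]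
    (f : Polynomial O) (hf : IsDistinguishedAt ℓ f) :
    Nat.card ((PowerSeries O ⧸ Ideal.span {(f : PowerSeries O)}) ⧸
      (Ideal.span {(ℓ : PowerSeries O)} • (⊤ : Submodule (PowerSeries O)
        (PowerSeries O ⧸ Ideal.span {(f : PowerSeries O)})))) =
      ℓ ^ (Module.finrank ℤ_[ℓ] O * f.natDegree) := by
  set N := (Ideal.span {(ℓ : PowerSeries O)} • (⊤ : Submodule (PowerSeries O)
        (PowerSeries O ⧸ Ideal.span {(f : PowerSeries O)}))) with hN
  have hsurj : Function.Surjective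
      (Ideal.span {(f : PowerSeries O)}).mkQ.toAddMonoidHom :=
    Submodule.mkQ_surjective _
  have h1 := AddSubgroup.index_comap_of_surjective N.toAddSubgroup hsurj
  have h2 : AddSubgroup.comap (Ideal.span {(f : PowerSeries O)}).mkQ.toAddMonoidHom
      N.toAddSubgroup = (bigHom ℓ f.natDegree O).ker := by
    ext s
    rw [AddMonoidHom.mem_ker, bigHom_eq_zero ℓ f hf]
    change (Ideal.span {(f : PowerSeries O)}).mkQ s ∈ N ↔ _
    rw [hN, smul_top_eq, Submodule.mem_map]
    constructor
    · rintro ⟨y, hy, hys⟩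
      obtain ⟨t, rfl⟩ := Ideal.mem_span_singleton.1 hy
      have h3 : s - ℓ * t ∈ Ideal.span {(f : PowerSeries O)} :=
        (Submodule.Quotient.eq _).1 hys.symm
      obtain ⟨b, hb⟩ := Ideal.mem_span_singleton.1 h3
      exact ⟨t, b, by rw [← hb]; ring⟩
    · rintro ⟨t, b, rfl⟩
      refine ⟨ℓ * t, Ideal.mem_span_singleton.2 (dvd_mul_right _ _), ?_⟩
      refine (Submodule.Quotient.eq _).2 ?_
      rw [sub_add_cancel_left]
      exact neg_mem (Ideal.mul_mem_right _ _ (Ideal.mem_span_singleton_self _))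
  rw [h2, AddSubgroup.index_ker, AddMonoidHom.range_eq_top.2 (bigHom_surjective ℓ _)] at h1
  have h4 : Nat.card (⊤ : AddSubgroup (Fin f.natDegree → Fin (Module.finrank ℤ_[ℓ] O) → ZMod ℓ))
      = ℓ ^ (Module.finrank ℤ_[ℓ] O * f.natDegree) := by
    rw [AddSubgroup.card_top, Nat.card_fun, Nat.card_fun, Nat.card_zmod, Nat.card_fin,
      Nat.card_fin, ← pow_mul]
  rw [← h4, h1]
  rfl

theorem card_pow {R M : Type*} [CommRing R] [AddCommGroup M] [Module R M] (r : R)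
    (hr : ∀ x : M, r • x = 0 → x = 0) (q : ℕ)
    (hq : Nat.card (M ⧸ (Ideal.span {r} • (⊤ : Submodule R M))) = q) (m : ℕ) :
    Nat.card (M ⧸ (Ideal.span {r ^ m} • (⊤ : Submodule R M))) = q ^ m := by
  induction m with
  | zero =>
    have : Ideal.span {r ^ 0} • (⊤ : Submodule R M) = ⊤ := by simp
    rw [this]; simp
  | succ m ih =>
    have : Ideal.span {r ^ (m + 1)} • (⊤ : Submodule R M) =
        Ideal.span {r} • (Ideal.span {r ^ m} • (⊤ : Submodule R M)) := by
      rw [← mul_smul, Ideal.span_singleton_mul_span_singleton, pow_succ']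
    rw [this, card_smul r hr, ih, hq, pow_succ]

theorem card_dvd {R M : Type*} [CommRing R] [AddCommGroup M] [Module R M]
    (N P : Submodule R M) (h : N ≤ P) : Nat.card (M ⧸ P) ∣ Nat.card (M ⧸ N) :=
  AddSubgroup.index_dvd_of_le (H := N.toAddSubgroup) (K := P.toAddSubgroup) h

end NablaAux

/-- For `X = Λ_O/fΛ_O` with `f` distinguished of degree `e` over the valuation ring `O`
of a finite unramified extension of `ℚ_ℓ` of degree `d`: for all large `n`,
`∇_{n+1}X = ℓ∇_nX`, and `(X : ∇_nX) = ℓ^(d·e·n + c)` for a constant `c ∈ ℤ`. -/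
theorem nabla_quotient_distinguished (ℓ : ℕ) [Fact ℓ.Prime]
    (O : Type*) [CommRing O] [IsDomain O] [Algebra ℤ_[ℓ] O]
    [Module.Finite ℤ_[ℓ] O] [Module.Free ℤ_[ℓ] O]
    (hmax : (Ideal.span {(ℓ : O)}).IsMaximal)
    (huniq : ∀ M : Ideal O, M.IsMaximal → M = Ideal.span {(ℓ : O)})
    (f : Polynomial O) (hf : IsDistinguishedAt ℓ f) :
    ∃ n₀ : ℕ,
      (∀ n ≥ n₀,
        nablaO O ℓ (n + 1) • (⊤ : Submodule (PowerSeries O)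
            (PowerSeries O ⧸ Ideal.span {(f : PowerSeries O)})) =
          Ideal.span {(ℓ : PowerSeries O)} •
            (nablaO O ℓ n • (⊤ : Submodule (PowerSeries O)
              (PowerSeries O ⧸ Ideal.span {(f : PowerSeries O)})))) ∧
      ∃ c : ℤ, ∀ n ≥ n₀,
        (Nat.card ((PowerSeries O ⧸ Ideal.span {(f : PowerSeries O)}) ⧸
            (nablaO O ℓ n • (⊤ : Submodule (PowerSeries O)
              (PowerSeries O ⧸ Ideal.span {(f : PowerSeries O)})))) : ℚ) =
          (ℓ : ℚ) ^ ((Module.finrank ℤ_[ℓ] O * f.natDegree * n : ℤ) + c) := by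
  have hp : ℓ.Prime := Fact.out
  have h0 : (ℓ : O) ≠ 0 := by
    intro h
    have h1 : (ℓ : ℤ_[ℓ]) • (1 : O) = 0 := by
      rw [Algebra.smul_def, map_natCast, h, zero_mul]
    rcases smul_eq_zero.1 h1 with h2 | h2
    · exact hp.ne_zero (by exact_mod_cast h2)
    · exact one_ne_zero h2
  have hreg := NablaAux.regular ℓ h0 f hf
  have hcard := NablaAux.card_mod ℓ f hf
  have hstep := NablaAux.nabla_succ ℓ f hf hmax huniq
  refine ⟨f.natDegree + 1, hstep, ?_⟩
  have hbase : ∃ k, Nat.card ((PowerSeries O ⧸ Ideal.span {(f : PowerSeries O)}) ⧸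
            (nablaO O ℓ (f.natDegree + 1) • (⊤ : Submodule (PowerSeries O)
              (PowerSeries O ⧸ Ideal.span {(f : PowerSeries O)})))) = ℓ ^ k := by
    have h1 := NablaAux.card_pow _ hreg _ hcard (f.natDegree + 1 + 1)
    have h2 := NablaAux.card_dvd
      (Ideal.span {(ℓ : PowerSeries O) ^ (f.natDegree + 1 + 1)} • (⊤ : Submodule (PowerSeries O)
              (PowerSeries O ⧸ Ideal.span {(f : PowerSeries O)})))
      (nablaO O ℓ (f.natDegree + 1) • (⊤ : Submodule (PowerSeries O)
              (PowerSeries O ⧸ Ideal.span {(f : PowerSeries O)})))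
      (Submodule.smul_mono_left (Ideal.span_mono (by simp)))
    rw [h1, ← pow_mul] at h2
    obtain ⟨k, -, hk⟩ := (Nat.dvd_prime_pow hp).1 h2
    exact ⟨k, hk⟩
  obtain ⟨k, hk⟩ := hbase
  have hl : (ℓ : ℚ) ≠ 0 := by exact_mod_cast hp.ne_zero
  refine ⟨k - Module.finrank ℤ_[ℓ] O * f.natDegree * ((f.natDegree + 1 : ℕ) : ℤ), ?_⟩
  intro n hn
  induction n, hn using Nat.le_induction with
  | base =>
    rw [hk, add_sub_cancel, zpow_natCast, Nat.cast_pow]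
  | succ n hn ih =>
    rw [hstep n hn, NablaAux.card_smul _ hreg, hcard, Nat.cast_mul, ih, Nat.cast_pow,
      ← zpow_natCast, ← zpow_add₀ hl]
    congr 1
    push_cast
    ring
end

section
/- Let E be an elementary Λ-module over Λ = ℤ_ℓ[[T]] (a finite direct sum of copies of Λ, of Λ/ℓ^mΛ, and of Λ/fΛ with f distinguished), and let X ⊆ E be a Λ-submodule of finite index. Then the sequence of indices ((ℓ^{n+1}E ∩ ω_nE) : (ℓ^{n+1}X ∩ ω_nX)) is eventually constant as n → ∞, where ω_n = (1+T)^{ℓ^n} − 1. -/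
/-- The Iwasawa algebra `Λ = ℤ_ℓ[[T]]`. -/
abbrev Lam (ℓ : ℕ) [Fact ℓ.Prime] := PowerSeries ℤ_[ℓ]

/-- `ω_n = (1+T)^(ℓ^n) - 1`. -/
noncomputable def omegaIw (ℓ : ℕ) [Fact ℓ.Prime] (n : ℕ) : Lam ℓ :=
  (1 + PowerSeries.X) ^ (ℓ ^ n) - 1

/-- The elementary `Λ`-module `Λ^ρ ⊕ (⊕_i Λ/f_iΛ) ⊕ (⊕_j Λ/ℓ^(m_j)Λ)`. -/
abbrev ElemMod (ℓ : ℕ) [Fact ℓ.Prime] (ρ : ℕ) {ι κ : Type}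
    (f : ι → Polynomial ℤ_[ℓ]) (m : κ → ℕ) : Type :=
  (Fin ρ → Lam ℓ) × ((i : ι) → Lam ℓ ⧸ Ideal.span {((f i : Lam ℓ))}) ×
    ((j : κ) → Lam ℓ ⧸ Ideal.span {(ℓ : Lam ℓ) ^ (m j)})

/-- `∂ⁿN = ℓ^(n+1)N ∩ ω_nN` for a submodule `N` of a `Λ`-module. -/
noncomputable def partialN (ℓ : ℕ) [Fact ℓ.Prime] {M : Type*} [AddCommGroup M]
    [Module (Lam ℓ) M] (n : ℕ) (N : Submodule (Lam ℓ) M) : Submodule (Lam ℓ) M :=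
  (Ideal.span {(ℓ : Lam ℓ) ^ (n + 1)}) • N ⊓ (Ideal.span {omegaIw ℓ n}) • N

open Filter

section helper

variable {ℓ : ℕ} [Fact ℓ.Prime]

lemma omega_succ (n : ℕ) : ∃ s : Lam ℓ,
    omegaIw ℓ (n+1) = omegaIw ℓ n * (ℓ + omegaIw ℓ n * s) := by
  obtain ⟨s, hs⟩ := Polynomial.powAddExpansion (1 : Lam ℓ) (omegaIw ℓ n) ℓ
  refine ⟨s, ?_⟩
  have h : omegaIw ℓ (n+1) = (1 + omegaIw ℓ n) ^ ℓ - 1 := by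
    simp [omegaIw, pow_succ, pow_mul]
  rw [h, hs]
  simp
  ring

lemma omega_mem (n : ℕ) : omegaIw ℓ n ∈ (Ideal.span {(ℓ : Lam ℓ)} ⊔ Ideal.span {(PowerSeries.X : Lam ℓ)}) ^ (n+1) := by
  set I : Ideal (Lam ℓ) := (Ideal.span {(ℓ : Lam ℓ)} ⊔ Ideal.span {(PowerSeries.X : Lam ℓ)}) with hI
  induction n with
  | zero =>
    have : omegaIw ℓ 0 = PowerSeries.X := by simp [omegaIw]
    rw [this, zero_add, pow_one]
    exact Ideal.mem_sup_right (Ideal.mem_span_singleton_self _)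
  | succ n ih =>
    obtain ⟨s, hs⟩ := omega_succ (ℓ := ℓ) n
    rw [hs, pow_succ I (n+1)]
    refine Ideal.mul_mem_mul ih (I.add_mem (Ideal.mem_sup_left (Ideal.mem_span_singleton_self _)) ?_)
    exact I.mul_mem_right _ (Ideal.pow_le_self (by simp) ih)

lemma omega_ev (k : ℕ) : ∀ᶠ n in atTop, ∃ a b : Lam ℓ,
    omegaIw ℓ n = (ℓ : Lam ℓ)^k * a + PowerSeries.X^k * b := by
  filter_upwards [eventually_ge_atTop (k+k)] with n hn
  have h := Ideal.sup_pow_add_le_pow_sup_pow (Ideal.pow_le_pow_right (by omega : k + k ≤ n+1) (omega_mem (ℓ := ℓ) n))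
  rw [Ideal.span_singleton_pow, Ideal.span_singleton_pow, Submodule.mem_sup] at h
  obtain ⟨y, hy, z, hz, h⟩ := h
  obtain ⟨a, rfl⟩ := Ideal.mem_span_singleton'.1 hy
  obtain ⟨b, rfl⟩ := Ideal.mem_span_singleton'.1 hz
  exact ⟨a, b, by rw [← h]; ring⟩

lemma ell_dvd_iff (g : Lam ℓ) : (ℓ : Lam ℓ) ∣ g ↔ PowerSeries.map (PadicInt.toZMod (p := ℓ)) g = 0 := by
  constructor
  · rintro ⟨h, rfl⟩
    rw [map_mul, map_natCast]
    have : ((ℓ : ℕ) : PowerSeries (ZMod ℓ)) = 0 := by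
      rw [← map_natCast (algebraMap (ZMod ℓ) (PowerSeries (ZMod ℓ))), ZMod.natCast_self, map_zero]
    rw [this, zero_mul]
  · intro h
    have h1 : ∀ i, (ℓ : ℤ_[ℓ]) ∣ PowerSeries.coeff i g := by
      intro i
      have h2 := congrArg (PowerSeries.coeff i) h
      rw [PowerSeries.coeff_map, map_zero, ← RingHom.mem_ker, PadicInt.ker_toZMod,
        PadicInt.maximalIdeal_eq_span_p, Ideal.mem_span_singleton] at h2
      exact h2
    choose c hc using h1
    refine ⟨PowerSeries.mk c, ?_⟩
    ext i
    have : ((ℓ : ℕ) : Lam ℓ) = PowerSeries.C ((ℓ : ℕ) : ℤ_[ℓ]) := by simp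
    rw [this, PowerSeries.coeff_C_mul, PowerSeries.coeff_mk, hc]

lemma ell_ne_zero : (ℓ : Lam ℓ) ≠ 0 := by
  intro h
  have h1 := congrArg (PowerSeries.constantCoeff) h
  rw [map_natCast, map_zero] at h1
  exact (Fact.out : ℓ.Prime).ne_zero (by exact_mod_cast h1)

lemma ell_prime : Prime (ℓ : Lam ℓ) := by
  refine ⟨ell_ne_zero, ?_, ?_⟩
  · intro h
    have h1 := (ell_dvd_iff (1 : Lam ℓ)).1 h.dvd
    simp at h1
  · intro a b h
    rw [ell_dvd_iff] at *
    rw [ell_dvd_iff]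
    rw [map_mul] at h
    exact mul_eq_zero.1 h

lemma ell_not_dvd_omega (n : ℕ) : ¬ (ℓ : Lam ℓ) ∣ omegaIw ℓ n := by
  rw [ell_dvd_iff, omegaIw]
  have : CharP (PowerSeries (ZMod ℓ)) ℓ :=
    charP_of_injective_algebraMap (algebraMap (ZMod ℓ) (PowerSeries (ZMod ℓ))).injective ℓ
  rw [map_sub, map_pow, map_add, map_one, PowerSeries.map_X, add_pow_char_pow, one_pow, add_sub_cancel_left]
  exact pow_ne_zero _ PowerSeries.X_ne_zero

lemma ell_not_dvd_f {f : Polynomial ℤ_[ℓ]} (hf : IsDistinguishedAt ℓ f) : ¬ (ℓ : Lam ℓ) ∣ (f : Lam ℓ) := by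
  rw [ell_dvd_iff]
  intro h
  have h2 := congrArg (PowerSeries.coeff f.natDegree) h
  rw [PowerSeries.coeff_map, Polynomial.coeff_coe, hf.1.coeff_natDegree] at h2
  simp at h2

lemma f_dvd_of_mul {f : Polynomial ℤ_[ℓ]} (hf : IsDistinguishedAt ℓ f) (j : ℕ) (g : Lam ℓ)
    (h : (f : Lam ℓ) ∣ (ℓ : Lam ℓ)^j * g) : (f : Lam ℓ) ∣ g := by
  obtain ⟨c, hc⟩ := h
  have h1 : (ℓ : Lam ℓ)^j ∣ (f : Lam ℓ) * c := ⟨g, hc.symm⟩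
  obtain ⟨d, rfl⟩ := ell_prime.pow_dvd_of_dvd_mul_left _ (ell_not_dvd_f hf) h1
  refine ⟨d, mul_left_cancel₀ (pow_ne_zero j ell_ne_zero) ?_⟩
  rw [hc]; ring

lemma omega_ev_f {f : Polynomial ℤ_[ℓ]} (hf : IsDistinguishedAt ℓ f) (k : ℕ) :
    ∀ᶠ n in atTop, ∃ a b : Lam ℓ, omegaIw ℓ n = (ℓ : Lam ℓ)^k * a + f * b := by
  -- X^d = f + ℓ * c
  obtain ⟨c, hc⟩ : ∃ c : Lam ℓ, (f : Lam ℓ) - PowerSeries.X ^ f.natDegree = (ℓ : Lam ℓ) * c := by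
    change (ℓ : Lam ℓ) ∣ _
    rw [ell_dvd_iff]
    ext i
    rw [PowerSeries.coeff_map, map_sub, Polynomial.coeff_coe, PowerSeries.coeff_X_pow, map_zero]
    rcases lt_trichotomy i f.natDegree with h | h | h
    · rw [if_neg h.ne, sub_zero, ← RingHom.mem_ker, PadicInt.ker_toZMod,
        PadicInt.maximalIdeal_eq_span_p]
      exact hf.2 i h
    · subst h
      simp [hf.1.coeff_natDegree]
    · rw [if_neg h.ne', Polynomial.coeff_eq_zero_of_natDegree_lt h]; simp
  have key : ∀ j : ℕ, ∃ a b : Lam ℓ, PowerSeries.X ^ (f.natDegree * j) = (ℓ : Lam ℓ)^j * a + (f : Lam ℓ) * b := by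
    intro j
    induction j with
    | zero => exact ⟨1, 0, by simp⟩
    | succ j ih =>
      obtain ⟨a, b, h⟩ := ih
      refine ⟨-(c * a), (ℓ : Lam ℓ)^j * a + b * PowerSeries.X ^ f.natDegree, ?_⟩
      have hX : (PowerSeries.X : Lam ℓ) ^ f.natDegree = (f : Lam ℓ) - (ℓ : Lam ℓ) * c := by rw [← hc]; ring
      rw [mul_add, pow_add, h, mul_one, hX]; ring
  filter_upwards [omega_ev (ℓ := ℓ) ((f.natDegree + 1) * k)] with n ⟨a, b, h⟩
  obtain ⟨a', b', h'⟩ := key k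
  refine ⟨(ℓ : Lam ℓ)^(f.natDegree * k) * a + a' * PowerSeries.X ^ k * b, b' * PowerSeries.X ^ k * b, ?_⟩
  rw [h, add_mul, one_mul, pow_add, pow_add, h']
  ring

/-- approximate relations -/
def WW (ℓ : ℕ) [Fact ℓ.Prime] {M : Type*} [AddCommGroup M] [Module (Lam ℓ) M] (k n : ℕ) (x y : M) : Prop :=
  ∃ a b c d : M, (ℓ : Lam ℓ)^(n+1) • (x + (ℓ : Lam ℓ)^k • a + (PowerSeries.X : Lam ℓ)^k • b)
    + omegaIw ℓ n • (y + (ℓ : Lam ℓ)^k • c + (PowerSeries.X : Lam ℓ)^k • d) = 0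

def StW (ℓ : ℕ) [Fact ℓ.Prime] (M : Type*) [AddCommGroup M] [Module (Lam ℓ) M] (k : ℕ) : Prop :=
  ∃ S : M → M → Prop, ∀ᶠ n in atTop, ∀ x y : M, WW ℓ k n x y ↔ S x y

lemma StW.pi {ι : Type*} [Finite ι] {M : ι → Type*} [∀ i, AddCommGroup (M i)]
    [∀ i, Module (Lam ℓ) (M i)] {k : ℕ} (h : ∀ i, StW ℓ (M i) k) : StW ℓ (∀ i, M i) k := by
  choose S hS using h
  refine ⟨fun x y => ∀ i, S i (x i) (y i), ?_⟩
  filter_upwards [eventually_all.2 hS] with n hn x y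
  simp_rw [← hn]
  constructor
  · rintro ⟨a, b, c, d, h⟩ i
    exact ⟨a i, b i, c i, d i, congrFun h i⟩
  · intro h
    choose a b c d h using h
    exact ⟨a, b, c, d, funext h⟩

lemma StW.prod {M N : Type*} [AddCommGroup M] [AddCommGroup N]
    [Module (Lam ℓ) M] [Module (Lam ℓ) N] {k : ℕ} (h : StW ℓ M k) (h' : StW ℓ N k) :
    StW ℓ (M × N) k := by
  obtain ⟨S, hS⟩ := h
  obtain ⟨S', hS'⟩ := h'
  refine ⟨fun x y => S x.1 y.1 ∧ S' x.2 y.2, ?_⟩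
  filter_upwards [hS, hS'] with n hn hn' x y
  rw [← hn, ← hn']
  constructor
  · rintro ⟨a, b, c, d, h⟩
    exact ⟨⟨a.1, b.1, c.1, d.1, congrArg Prod.fst h⟩, ⟨a.2, b.2, c.2, d.2, congrArg Prod.snd h⟩⟩
  · rintro ⟨⟨a, b, c, d, h⟩, ⟨a', b', c', d', h'⟩⟩
    exact ⟨(a, a'), (b, b'), (c, c'), (d, d'), Prod.ext h h'⟩

lemma StW.equiv {M N : Type*} [AddCommGroup M] [AddCommGroup N]
    [Module (Lam ℓ) M] [Module (Lam ℓ) N] {k : ℕ} (e : M ≃ₗ[Lam ℓ] N) (h : StW ℓ N k) :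
    StW ℓ M k := by
  obtain ⟨S, hS⟩ := h
  refine ⟨fun x y => S (e x) (e y), ?_⟩
  filter_upwards [hS] with n hn x y
  rw [← hn]
  constructor
  · rintro ⟨a, b, c, d, h⟩
    exact ⟨e a, e b, e c, e d, by simpa using congrArg e h⟩
  · rintro ⟨a, b, c, d, h⟩
    refine ⟨e.symm a, e.symm b, e.symm c, e.symm d, e.injective ?_⟩
    simpa using h

lemma StW.free (k : ℕ) : StW ℓ (Lam ℓ) k := by
  refine ⟨fun x y => (∃ a b : Lam ℓ, x = (ℓ : Lam ℓ)^k • a + (PowerSeries.X : Lam ℓ)^k • b) ∧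
    (∃ a b : Lam ℓ, y = (ℓ : Lam ℓ)^k • a + (PowerSeries.X : Lam ℓ)^k • b), ?_⟩
  filter_upwards [omega_ev (ℓ := ℓ) k, eventually_ge_atTop k] with n ⟨u, v, hn⟩ hk x y
  constructor
  · rintro ⟨a, b, c, d, h⟩
    simp only [smul_eq_mul] at *
    have h1 : (ℓ : Lam ℓ)^(n+1) ∣ omegaIw ℓ n * (y + (ℓ : Lam ℓ)^k * c + (PowerSeries.X : Lam ℓ)^k * d) :=
      ⟨-(x + (ℓ : Lam ℓ)^k * a + (PowerSeries.X : Lam ℓ)^k * b), by linear_combination h⟩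
    obtain ⟨z, hz⟩ := ell_prime.pow_dvd_of_dvd_mul_left _ (ell_not_dvd_omega n) h1
    have hx : x + (ℓ : Lam ℓ)^k * a + (PowerSeries.X : Lam ℓ)^k * b = - omegaIw ℓ n * z := by
      refine mul_left_cancel₀ (pow_ne_zero (n+1) ell_ne_zero) ?_
      rw [hz] at h
      linear_combination h
    obtain ⟨j, rfl⟩ := Nat.exists_eq_add_of_le hk
    refine ⟨⟨-(u*z) - a, -(v*z) - b, ?_⟩, ⟨(ℓ : Lam ℓ)^(j+1) * z - c, -d, ?_⟩⟩
    · rw [hn] at hx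
      linear_combination hx
    · linear_combination hz
  · rintro ⟨⟨a, b, rfl⟩, ⟨c, d, rfl⟩⟩
    refine ⟨-a, -b, -c, -d, ?_⟩
    simp only [smul_eq_mul]
    ring

lemma StW.ell (k m : ℕ) : StW ℓ (Lam ℓ ⧸ Ideal.span {(ℓ : Lam ℓ) ^ m}) k := by
  refine ⟨fun x y => 
    (∃ a b, y + (ℓ : Lam ℓ)^k • a + (PowerSeries.X : Lam ℓ)^k • b = 0), ?_⟩
  have h0 : ∀ n, m ≤ n → ∀ x : Lam ℓ ⧸ Ideal.span {(ℓ : Lam ℓ) ^ m}, (ℓ : Lam ℓ)^n • x = 0 := by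
    intro n hn x
    obtain ⟨x, rfl⟩ := Ideal.Quotient.mk_surjective x
    rw [← Ideal.Quotient.mk_eq_mk, ← Submodule.Quotient.mk_smul, Submodule.Quotient.mk_eq_zero,
      Ideal.mem_span_singleton, smul_eq_mul]
    exact (pow_dvd_pow _ hn).mul_right _
  have h1 : ∀ n, ∀ x : Lam ℓ ⧸ Ideal.span {(ℓ : Lam ℓ) ^ m}, omegaIw ℓ n • x = 0 → x = 0 := by
    intro n x
    obtain ⟨x, rfl⟩ := Ideal.Quotient.mk_surjective x
    rw [← Ideal.Quotient.mk_eq_mk, ← Submodule.Quotient.mk_smul, Submodule.Quotient.mk_eq_zero,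
      Submodule.Quotient.mk_eq_zero,
      Ideal.mem_span_singleton, Ideal.mem_span_singleton, smul_eq_mul]
    exact ell_prime.pow_dvd_of_dvd_mul_left _ (ell_not_dvd_omega n)
  filter_upwards [eventually_ge_atTop m] with n hn x y
  constructor
  · rintro ⟨a, b, c, d, h⟩
    rw [h0 (n+1) (by omega), zero_add] at h
    exact ⟨c, d, h1 n _ h⟩
  · rintro ⟨c, d, h⟩
    refine ⟨0, 0, c, d, ?_⟩
    rw [h0 (n+1) (by omega), zero_add, h, smul_zero]

lemma omega_form {f : Polynomial ℤ_[ℓ]} (hf : IsDistinguishedAt ℓ f) (k : ℕ) :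
    ∃ n₁, ∀ j, ∃ w g : Lam ℓ,
      omegaIw ℓ (n₁ + j) = (ℓ : Lam ℓ)^j * (1 + (ℓ : Lam ℓ)^k * w) * omegaIw ℓ n₁ + f * g := by
  obtain ⟨n₁, h⟩ := eventually_atTop.1 (omega_ev_f hf (k+1))
  refine ⟨n₁, fun j => ?_⟩
  induction j with
  | zero => exact ⟨0, 0, by simp⟩
  | succ j ih =>
    obtain ⟨w, g, hw⟩ := ih
    obtain ⟨s, hs⟩ := omega_succ (ℓ := ℓ) (n₁ + j)
    obtain ⟨a, b, hab⟩ := h (n₁ + j) (by omega)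
    refine ⟨w + a * s + (ℓ : Lam ℓ)^k * w * a * s, omegaIw ℓ (n₁ + j) * b * s + g * (ℓ + (ℓ : Lam ℓ)^(k+1) * a * s), ?_⟩
    rw [← add_assoc, hs]
    have : omegaIw ℓ (n₁ + j) * (ℓ + omegaIw ℓ (n₁ + j) * s) =
      omegaIw ℓ (n₁ + j) * (ℓ + ((ℓ : Lam ℓ)^(k+1) * a + f * b) * s) := by rw [← hab]
    rw [this]
    linear_combination (ℓ + ((ℓ : Lam ℓ)^(k+1) * a) * s) * hw

lemma one_add_unit (k : ℕ) (hk : 0 < k) (w : Lam ℓ) : ∃ w', (1 + (ℓ : Lam ℓ)^k * w) * (1 + (ℓ : Lam ℓ)^k * w') = 1 := by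
  have hu : IsUnit (1 + (ℓ : Lam ℓ)^k * w) := by
    rw [PowerSeries.isUnit_iff_constantCoeff]
    rw [map_add, map_mul, map_pow, map_one, map_natCast, add_comm]
    by_contra h
    have h1 : (ℓ : ℤ_[ℓ])^k * PowerSeries.constantCoeff w ∈ IsLocalRing.maximalIdeal ℤ_[ℓ] := by
      refine Ideal.mul_mem_right _ _ (Ideal.pow_mem_of_mem _ ?_ _ hk)
      rw [PadicInt.maximalIdeal_eq_span_p]
      exact Ideal.mem_span_singleton_self _
    have h2 := (Ideal.add_mem_iff_right _ h1).1 ((IsLocalRing.mem_maximalIdeal _).2 h)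
    exact (IsLocalRing.mem_maximalIdeal _).1 h2 isUnit_one
  obtain ⟨v, hv⟩ := hu.exists_right_inv
  exact ⟨-w * v, by linear_combination (-(ℓ : Lam ℓ)^k * w) * hv⟩

lemma aux1 {R M : Type*} [CommRing R] [AddCommGroup M] [Module R M] (A B C w o : R) (x y : M) :
    (B * A) • x + ((A * (1 + C * w) * o) • y + 0) = A • (B • x + o • ((1 + C * w) • y)) := by
  module

lemma aux2 {R M : Type*} [CommRing R] [AddCommGroup M] [Module R M] (B C w o t : R)
    (x y a b c d : M) :
    B • (x + C • a + t • b) + o • (y + C • (w • y + (1 + C * w) • c) + t • (1 + C * w) • d) =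
    B • (x + C • a + t • b) + o • ((1 + C * w) • (y + C • c + t • d)) := by
  module

lemma aux3 {R M : Type*} [CommRing R] [AddCommGroup M] [Module R M] (C w t : R) (y c d : M) :
    y + C • (w • y + (1 + C * w) • c) + t • (1 + C * w) • d =
      (1 + C * w) • (y + C • c + t • d) := by
  module

lemma StW.dist {f : Polynomial ℤ_[ℓ]} (hf : IsDistinguishedAt ℓ f) (k : ℕ) (hk : 0 < k) :
    StW ℓ (Lam ℓ ⧸ Ideal.span {(f : Lam ℓ)}) k := by
  obtain ⟨n₁, h⟩ := omega_form hf k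
  have h0 : ∀ j, ∀ x : Lam ℓ ⧸ Ideal.span {(f : Lam ℓ)}, (ℓ : Lam ℓ)^j • x = 0 → x = 0 := by
    intro j x
    obtain ⟨x, rfl⟩ := Ideal.Quotient.mk_surjective x
    rw [← Ideal.Quotient.mk_eq_mk, ← Submodule.Quotient.mk_smul, Submodule.Quotient.mk_eq_zero,
      Submodule.Quotient.mk_eq_zero,
      Ideal.mem_span_singleton, Ideal.mem_span_singleton, smul_eq_mul]
    exact f_dvd_of_mul hf j x
  have hf0 : ∀ (g : Lam ℓ) (x : Lam ℓ ⧸ Ideal.span {(f : Lam ℓ)}), ((f : Lam ℓ) * g) • x = 0 := by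
    intro g x
    obtain ⟨x, rfl⟩ := Ideal.Quotient.mk_surjective x
    rw [← Ideal.Quotient.mk_eq_mk, ← Submodule.Quotient.mk_smul, Submodule.Quotient.mk_eq_zero,
      Ideal.mem_span_singleton, smul_eq_mul]
    exact ⟨g * x, by ring⟩
  refine ⟨WW ℓ k n₁, ?_⟩
  filter_upwards [eventually_ge_atTop n₁] with n hn x y
  obtain ⟨j, rfl⟩ := Nat.exists_eq_add_of_le hn
  obtain ⟨w, g, hw⟩ := h j
  -- relation at n in terms of relation at n₁
  have hrel : ∀ x y : Lam ℓ ⧸ Ideal.span {(f : Lam ℓ)},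
      (ℓ : Lam ℓ)^(n₁ + j + 1) • x + omegaIw ℓ (n₁ + j) • y = 0 ↔
      (ℓ : Lam ℓ)^(n₁ + 1) • x + omegaIw ℓ n₁ • ((1 + (ℓ : Lam ℓ)^k * w) • y) = 0 := by
    intro x y
    have : (ℓ : Lam ℓ)^(n₁ + j + 1) • x + omegaIw ℓ (n₁ + j) • y = (ℓ : Lam ℓ)^j •
        ((ℓ : Lam ℓ)^(n₁ + 1) • x + omegaIw ℓ n₁ • ((1 + (ℓ : Lam ℓ)^k * w) • y)) := by
      rw [hw, add_smul, hf0, show n₁ + j + 1 = (n₁ + 1) + j by ring, pow_add]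
      exact aux1 _ _ _ _ _ _ _
    rw [this]
    exact ⟨h0 _ _, fun h => by rw [h, smul_zero]⟩
  unfold WW
  simp_rw [hrel]
  constructor
  · rintro ⟨a, b, c, d, h⟩
    refine ⟨a, b, w • y + (1 + (ℓ : Lam ℓ)^k * w) • c, (1 + (ℓ : Lam ℓ)^k * w) • d, ?_⟩
    rw [← h]
    exact aux2 _ _ _ _ _ _ _ _ _ _ _
  · rintro ⟨a, b, c, d, h⟩
    obtain ⟨w', hw'⟩ := one_add_unit k hk w
    refine ⟨a, b, w' • y + (1 + (ℓ : Lam ℓ)^k * w') • c, (1 + (ℓ : Lam ℓ)^k * w') • d, ?_⟩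
    have : y + (ℓ : Lam ℓ)^k • (w' • y + (1 + (ℓ : Lam ℓ)^k * w') • c) + 
        (PowerSeries.X : Lam ℓ)^k • (1 + (ℓ : Lam ℓ)^k * w') • d =
        (1 + (ℓ : Lam ℓ)^k * w') • (y + (ℓ : Lam ℓ)^k • c + (PowerSeries.X : Lam ℓ)^k • d) := by
      exact aux3 _ _ _ _ _ _
    rw [this, smul_smul (1 + (ℓ : Lam ℓ)^k * w), hw', one_smul, h]

/-- a non-unit kills a finite module up to a power -/
lemma nilp_finite {F : Type*} [AddCommGroup F] [Module (Lam ℓ) F] [Finite F] (r : Lam ℓ)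
    (hr : ¬ IsUnit r) : ∃ k, ∀ n ≥ k, ∀ x : F, r ^ n • x = 0 := by
  obtain ⟨i, j, hij, h⟩ := Finite.exists_ne_map_eq_of_infinite (fun n : ℕ => (fun x : F => r ^ n • x))
  wlog hlt : i < j generalizing i j
  · exact this j i hij.symm h.symm (by omega)
  obtain ⟨d, rfl⟩ := Nat.exists_eq_add_of_lt hlt
  have hu : IsUnit (1 - r ^ (d+1)) := by
    by_contra hn
    have h1 : r ^ (d+1) ∈ IsLocalRing.maximalIdeal (Lam ℓ) :=
      Ideal.pow_mem_of_mem _ ((IsLocalRing.mem_maximalIdeal _).2 hr) _ (by omega)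
    have h2 := Ideal.add_mem _ ((IsLocalRing.mem_maximalIdeal _).2 hn) h1
    rw [sub_add_cancel] at h2
    exact (IsLocalRing.mem_maximalIdeal _).1 h2 isUnit_one
  have hi : ∀ x : F, r ^ i • x = 0 := by
    intro x
    have h1 : r ^ i • x = r ^ (i + d + 1) • x := congrFun h x
    have h2 : (1 - r ^ (d+1)) • (r ^ i • x) = 0 := by
      rw [sub_smul, one_smul, smul_smul, ← pow_add, sub_eq_zero, h1]
      congr 2; ring
    obtain ⟨v, hv⟩ := hu.exists_left_inv
    rw [← one_smul (Lam ℓ) (r ^ i • x), ← hv, mul_smul, h2, smul_zero]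
  refine ⟨i, fun n hn x => ?_⟩
  obtain ⟨e, rfl⟩ := Nat.exists_eq_add_of_le hn
  rw [add_comm, pow_add, mul_smul, hi, smul_zero]

section index
variable {E : Type*} [AddCommGroup E] [Module (Lam ℓ) E]

/-- The relation module. -/
def KK (ℓ : ℕ) [Fact ℓ.Prime] (E : Type*) [AddCommGroup E] [Module (Lam ℓ) E] (n : ℕ) :
    Submodule (Lam ℓ) (E × E) where
  carrier := {p | (ℓ : Lam ℓ)^(n+1) • p.1 + omegaIw ℓ n • p.2 = 0}
  zero_mem' := by simp
  add_mem' := by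
    intro a b ha hb
    simp only [Set.mem_ofPred_eq, Prod.fst_add, Prod.snd_add] at *
    rw [smul_add, smul_add, add_add_add_comm, ha, hb, add_zero]
  smul_mem' := by
    intro c a ha
    simp only [Set.mem_ofPred_eq, Prod.smul_fst, Prod.smul_snd] at *
    rw [smul_comm _ c, smul_comm _ c, ← smul_add, ha, smul_zero]

def TT (ℓ : ℕ) [Fact ℓ.Prime] (E : Type*) [AddCommGroup E] [Module (Lam ℓ) E] (n : ℕ) :
    Submodule (Lam ℓ) (E × E) where
  carrier := {p | (ℓ : Lam ℓ)^(n+1) • p.1 = 0 ∧ omegaIw ℓ n • p.2 = 0}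
  zero_mem' := by simp
  add_mem' := by
    intro a b ha hb
    simp only [Set.mem_ofPred_eq, Prod.fst_add, Prod.snd_add] at *
    simp [ha, hb]
  smul_mem' := by
    intro c a ha
    simp only [Set.mem_ofPred_eq, Prod.smul_fst, Prod.smul_snd] at *
    rw [smul_comm _ c, smul_comm _ c, ha.1, ha.2, smul_zero]; simp

lemma TT_mono : Monotone (TT ℓ E) := by
  refine monotone_nat_of_le_succ fun n p hp => ?_
  obtain ⟨s, hs⟩ := omega_succ (ℓ := ℓ) n
  refine ⟨?_, ?_⟩
  · rw [pow_succ', mul_smul, hp.1, smul_zero]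
  · rw [hs, mul_comm, mul_smul, hp.2, smul_zero]

lemma mem_partialN (n : ℕ) (X : Submodule (Lam ℓ) E) (z : E) :
    z ∈ partialN ℓ n X ↔ (∃ x ∈ X, (ℓ : Lam ℓ)^(n+1) • x = z) ∧ ∃ y ∈ X, omegaIw ℓ n • y = z := by
  rw [partialN, Submodule.mem_inf, Submodule.ideal_span_singleton_smul, Submodule.ideal_span_singleton_smul,
    Submodule.mem_smul_pointwise_iff_exists, Submodule.mem_smul_pointwise_iff_exists]

lemma card_eq (X : Submodule (Lam ℓ) E) (n : ℕ) :
    Nat.card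
        (↥(partialN ℓ n (⊤ : Submodule (Lam ℓ) E)) ⧸
          Submodule.comap (partialN ℓ n (⊤ : Submodule (Lam ℓ) E)).subtype
            (partialN ℓ n X)) =
    Nat.card (↥(KK ℓ E n ⊔ X.prod X) ⧸
      Submodule.comap (KK ℓ E n ⊔ X.prod X).subtype (TT ℓ E n ⊔ X.prod X)) := by
  let φ₀ : KK ℓ E n →ₗ[Lam ℓ] (partialN ℓ n (⊤ : Submodule (Lam ℓ) E)) :=
    LinearMap.codRestrict _ (((ℓ : Lam ℓ)^(n+1)) • ((LinearMap.fst (Lam ℓ) E E) ∘ₗ (KK ℓ E n).subtype)) (by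
      rintro ⟨⟨x, y⟩, h⟩
      have h' : (ℓ : Lam ℓ)^(n+1) • x + omegaIw ℓ n • y = 0 := h
      rw [mem_partialN]
      refine ⟨⟨x, trivial, rfl⟩, ⟨-y, trivial, ?_⟩⟩
      rw [smul_neg]
      exact (eq_neg_of_add_eq_zero_left h').symm)
  have hφ₀ : ∀ p : KK ℓ E n, ((φ₀ p : _) : E) = (ℓ : Lam ℓ)^(n+1) • p.1.1 := fun p => rfl
  let φ := (Submodule.mkQ (Submodule.comap (partialN ℓ n (⊤ : Submodule (Lam ℓ) E)).subtype
            (partialN ℓ n X))) ∘ₗ φ₀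
  let ψ₀ : KK ℓ E n →ₗ[Lam ℓ] ↥(KK ℓ E n ⊔ X.prod X) := Submodule.inclusion le_sup_left
  let ψ := (Submodule.mkQ (Submodule.comap (KK ℓ E n ⊔ X.prod X).subtype (TT ℓ E n ⊔ X.prod X))) ∘ₗ ψ₀
  have hφ : Function.Surjective φ := by
    refine (Submodule.mkQ_surjective _).comp ?_
    rintro ⟨z, hz⟩
    obtain ⟨⟨x, -, hx⟩, ⟨y, -, hy⟩⟩ := (mem_partialN _ _ _).1 hz
    refine ⟨⟨(x, -y), ?_⟩, Subtype.ext hx⟩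
    change (ℓ : Lam ℓ)^(n+1) • x + omegaIw ℓ n • (-y) = 0
    rw [hx, smul_neg, hy, add_neg_cancel]
  have hψ : Function.Surjective ψ := by
    intro q
    obtain ⟨⟨p, hp⟩, rfl⟩ := Submodule.mkQ_surjective _ q
    obtain ⟨u, hu, v, hv, rfl⟩ := Submodule.mem_sup.1 hp
    refine ⟨⟨u, hu⟩, ?_⟩
    change Submodule.Quotient.mk _ = Submodule.Quotient.mk _
    rw [Submodule.Quotient.eq]
    change u - (u + v) ∈ TT ℓ E n ⊔ X.prod X
    rw [sub_add_cancel_left]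
    exact Submodule.mem_sup_right (neg_mem hv)
  have hker : LinearMap.ker φ = LinearMap.ker ψ := by
    ext ⟨⟨x, y⟩, hp⟩
    have h' : (ℓ : Lam ℓ)^(n+1) • x + omegaIw ℓ n • y = 0 := hp
    have e1 : (⟨(x, y), hp⟩ : KK ℓ E n) ∈ LinearMap.ker φ ↔ (ℓ : Lam ℓ)^(n+1) • x ∈ partialN ℓ n X := by
      rw [LinearMap.mem_ker]
      exact Submodule.Quotient.mk_eq_zero _
    have e2 : (⟨(x, y), hp⟩ : KK ℓ E n) ∈ LinearMap.ker ψ ↔ (x, y) ∈ TT ℓ E n ⊔ X.prod X := by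
      rw [LinearMap.mem_ker]
      exact Submodule.Quotient.mk_eq_zero _
    rw [e1, e2, mem_partialN, Submodule.mem_sup]
    constructor
    · rintro ⟨⟨a, ha, h1⟩, ⟨b, hb, h2⟩⟩
      refine ⟨(x - a, y + b), ⟨?_, ?_⟩, (a, -b), ⟨ha, neg_mem hb⟩, ?_⟩
      · change _ • (x - a) = 0
        rw [smul_sub, h1, sub_self]
      · change _ • (y + b) = 0
        rw [smul_add, h2, add_comm, h']
      · ext <;> simp
    · rintro ⟨⟨s, t⟩, ⟨hs, ht⟩, ⟨a, b⟩, ⟨ha, hb⟩, h⟩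
      obtain ⟨rfl, rfl⟩ := Prod.mk.inj h
      change (ℓ : Lam ℓ)^(n+1) • s = 0 at hs
      change omegaIw ℓ n • t = 0 at ht
      change a ∈ X at ha
      change b ∈ X at hb
      change (ℓ : Lam ℓ)^(n+1) • (s + a) + omegaIw ℓ n • (t + b) = 0 at h'
      change (∃ x ∈ X, (ℓ : Lam ℓ)^(n+1) • x = (ℓ : Lam ℓ)^(n+1) • (s + a)) ∧ ∃ y ∈ X, omegaIw ℓ n • y = (ℓ : Lam ℓ)^(n+1) • (s + a)
      rw [smul_add, smul_add, hs, ht, zero_add, zero_add] at h'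
      rw [smul_add, hs, zero_add]
      refine ⟨⟨a, ha, rfl⟩, ⟨-b, neg_mem hb, ?_⟩⟩
      rw [smul_neg]
      exact (eq_neg_of_add_eq_zero_left h').symm
  exact Nat.card_congr ((φ.quotKerEquivOfSurjective hφ).symm.trans
    ((Submodule.quotEquivOfEq _ _ hker).trans (ψ.quotKerEquivOfSurjective hψ))).toEquiv

lemma TT_stab (X : Submodule (Lam ℓ) E) [Finite (E ⧸ X)] :
    ∃ S, ∀ᶠ n in atTop, TT ℓ E n ⊔ X.prod X = S := by
  let π : E × E →ₗ[Lam ℓ] (E ⧸ X) × (E ⧸ X) := LinearMap.prodMap X.mkQ X.mkQ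
  have hπ : LinearMap.ker π = X.prod X := by
    rw [LinearMap.ker_prodMap, Submodule.ker_mkQ]
  obtain ⟨n₀, h⟩ := monotone_stabilizes_iff_noetherian.2
    (inferInstance : IsNoetherian (Lam ℓ) ((E ⧸ X) × (E ⧸ X)))
    ⟨fun n => (TT ℓ E n).map π, fun a b hab => Submodule.map_mono (TT_mono hab)⟩
  refine ⟨Submodule.comap π ((TT ℓ E n₀).map π), ?_⟩
  filter_upwards [eventually_ge_atTop n₀] with n hn
  have := h n hn
  change (TT ℓ E n₀).map π = (TT ℓ E n).map π at this
  rw [this, Submodule.comap_map_eq, hπ]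

lemma KK_stab (X : Submodule (Lam ℓ) E) (k : ℕ) (h1 : ∀ x : E, (ℓ : Lam ℓ)^k • x ∈ X)
    (h2 : ∀ x : E, (PowerSeries.X : Lam ℓ)^k • x ∈ X) (h : StW ℓ E k) :
    ∃ S, ∀ᶠ n in atTop, KK ℓ E n ⊔ X.prod X = S := by
  obtain ⟨S, hS⟩ := h
  have key : ∀ᶠ n in atTop, ∀ p : E × E, p ∈ KK ℓ E n ⊔ X.prod X ↔
      ∃ x ∈ X, ∃ y ∈ X, S (p.1 + x) (p.2 + y) := by
    filter_upwards [hS] with n hn p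
    simp_rw [← hn]
    rw [Submodule.mem_sup]
    constructor
    · rintro ⟨u, hu, v, hv, rfl⟩
      refine ⟨-v.1, neg_mem hv.1, -v.2, neg_mem hv.2, 0, 0, 0, 0, ?_⟩
      have hu' : (ℓ : Lam ℓ)^(n+1) • u.1 + omegaIw ℓ n • u.2 = 0 := hu
      simpa using hu'
    · rintro ⟨x, hx, y, hy, a, b, c, d, h⟩
      refine ⟨(_, _), h, (-(x + (ℓ : Lam ℓ)^k • a + (PowerSeries.X : Lam ℓ)^k • b),
        -(y + (ℓ : Lam ℓ)^k • c + (PowerSeries.X : Lam ℓ)^k • d)), ⟨?_, ?_⟩, ?_⟩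
      · exact neg_mem (add_mem (add_mem hx (h1 _)) (h2 _))
      · exact neg_mem (add_mem (add_mem hy (h1 _)) (h2 _))
      · ext <;> simp
  obtain ⟨n₀, hn₀⟩ := eventually_atTop.1 key
  refine ⟨KK ℓ E n₀ ⊔ X.prod X, ?_⟩
  filter_upwards [eventually_ge_atTop n₀] with n hn
  ext p
  rw [hn₀ n hn, hn₀ n₀ le_rfl]

end index

end helper

/-- For an elementary `Λ`-module `E = Λ^ρ ⊕ (⊕_i Λ/f_iΛ) ⊕ (⊕_j Λ/ℓ^(m_j)Λ)` (with
the `f_i` distinguished) and a submodule `X ⊆ E` of finite index, the indices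
`((ℓ^(n+1)E ∩ ω_nE) : (ℓ^(n+1)X ∩ ω_nX))` are eventually constant. -/
theorem elementary_submodule_partial_index_stationary (ℓ : ℕ) [Fact ℓ.Prime]
    (ρ : ℕ) (ι κ : Type) [Fintype ι] [Fintype κ]
    (f : ι → Polynomial ℤ_[ℓ]) (hf : ∀ i, IsDistinguishedAt ℓ (f i))
    (m : κ → ℕ) (hm : ∀ j, 0 < m j)
    (E : Type) [AddCommGroup E] [Module (Lam ℓ) E]
    (e : E ≃ₗ[Lam ℓ] ElemMod ℓ ρ f m)
    (X : Submodule (Lam ℓ) E) (hX : Finite (E ⧸ X)) :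
    ∃ n₀ c : ℕ, ∀ n ≥ n₀,
      Nat.card
        (↥(partialN ℓ n (⊤ : Submodule (Lam ℓ) E)) ⧸
          Submodule.comap (partialN ℓ n (⊤ : Submodule (Lam ℓ) E)).subtype
            (partialN ℓ n X)) = c := by
  obtain ⟨k1, hk1⟩ := nilp_finite (F := E ⧸ X) (ℓ : Lam ℓ) ell_prime.not_isUnit
  obtain ⟨k2, hk2⟩ := nilp_finite (ℓ := ℓ) (F := E ⧸ X) (PowerSeries.X : Lam ℓ)
    PowerSeries.X_prime.not_isUnit
  have hW : StW ℓ E (k1 + k2 + 1) := by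
    refine StW.equiv e (StW.prod (StW.pi fun _ => StW.free _) (StW.prod (StW.pi fun i => ?_) (StW.pi fun j => StW.ell _ _)))
    exact StW.dist (hf i) _ (by omega)
  obtain ⟨S, hS⟩ := KK_stab X (k1 + k2 + 1)
    (fun x => (Submodule.Quotient.mk_eq_zero X).1 (hk1 _ (by omega) (Submodule.Quotient.mk x)))
    (fun x => (Submodule.Quotient.mk_eq_zero X).1 (hk2 _ (by omega) (Submodule.Quotient.mk x))) hW
  obtain ⟨S', hS'⟩ := TT_stab X
  obtain ⟨n₀, h⟩ := eventually_atTop.1 (hS.and hS')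
  refine ⟨n₀, Nat.card (↥S ⧸ Submodule.comap S.subtype S'), fun n hn => ?_⟩
  obtain ⟨h1, h2⟩ := h n hn
  rw [card_eq, h2, h1]
end

section
/- Let E be an elementary Λ-module over Λ = ℤ_ℓ[[T]] and X ⊆ E a submodule of finite index. With ∇_nY = ℓ^{n+1}Y + ω_nY for a submodule Y and ω_n = (1+T)^{ℓ^n} − 1, the sequence of indices (∇_nE : ∇_nX) is eventually constant as n → ∞. -/
/-- `∇_nN = ℓ^(n+1)N + ω_nN` for a submodule `N` of a `Λ`-module. -/
noncomputable def nablaN (ℓ : ℕ) [Fact ℓ.Prime] {M : Type*} [AddCommGroup M]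
    [Module (Lam ℓ) M] (n : ℕ) (N : Submodule (Lam ℓ) M) : Submodule (Lam ℓ) M :=
  (Ideal.span {(ℓ : Lam ℓ) ^ (n + 1)}) • N ⊔ (Ideal.span {omegaIw ℓ n}) • N

open Filter

namespace NablaAux

variable {ℓ : ℕ} [hℓ : Fact ℓ.Prime]

/-- reduction modulo `ℓ` -/
noncomputable def red (ℓ : ℕ) [Fact ℓ.Prime] : Lam ℓ →+* PowerSeries (ZMod ℓ) :=
  PowerSeries.map PadicInt.toZMod

theorem dvd_iff (g : Lam ℓ) : (ℓ : Lam ℓ) ∣ g ↔ red ℓ g = 0 := by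
  constructor
  · rintro ⟨h, rfl⟩
    rw [map_mul, map_natCast]
    have : ((ℓ : ℕ) : PowerSeries (ZMod ℓ)) = 0 := by
      rw [← map_natCast (PowerSeries.C (R := ZMod ℓ))]
      simp
    rw [this, zero_mul]
  · intro h
    have h1 : ∀ i, ∃ c, PowerSeries.coeff i g = (ℓ : ℤ_[ℓ]) * c := by
      intro i
      have h2 : PadicInt.toZMod (PowerSeries.coeff i g) = 0 := by
        have := congrArg (PowerSeries.coeff i) h
        simpa [red] using this
      rw [← RingHom.mem_ker, PadicInt.ker_toZMod, PadicInt.maximalIdeal_eq_span_p,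
        Ideal.mem_span_singleton] at h2
      exact h2
    choose c hc using h1
    refine ⟨PowerSeries.mk c, ?_⟩
    ext i
    rw [← map_natCast (PowerSeries.C (R := ℤ_[ℓ])), PowerSeries.coeff_C_mul, hc,
      PowerSeries.coeff_mk]

theorem ell_ne_zero : (ℓ : Lam ℓ) ≠ 0 := by
  intro h
  rw [← map_natCast (PowerSeries.C (R := ℤ_[ℓ]))] at h
  have := congrArg (PowerSeries.coeff 0) h
  simp at this
  exact hℓ.out.ne_zero this

theorem prime_ell : Prime (ℓ : Lam ℓ) := by
  refine ⟨ell_ne_zero, ?_, ?_⟩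
  · intro h
    have h1 := (dvd_iff (1 : Lam ℓ)).1 h.dvd
    rw [map_one] at h1
    exact one_ne_zero h1
  · intro a b h
    rw [dvd_iff, map_mul, mul_eq_zero] at h
    rwa [dvd_iff, dvd_iff]

theorem not_dvd_omega (n : ℕ) : ¬ (ℓ : Lam ℓ) ∣ omegaIw ℓ n := by
  rw [dvd_iff, omegaIw, map_sub, map_pow, map_add, map_one]
  have : CharP (PowerSeries (ZMod ℓ)) ℓ :=
    charP_of_injective_ringHom (PowerSeries.C_injective (R := ZMod ℓ)) ℓ
  have : ExpChar (PowerSeries (ZMod ℓ)) ℓ := ExpChar.prime hℓ.out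
  rw [add_pow_expChar_pow]
  have : red ℓ PowerSeries.X = PowerSeries.X := by simp [red]
  rw [this, one_pow, add_sub_cancel_left]
  exact pow_ne_zero _ PowerSeries.X_ne_zero

theorem red_dist (f : Polynomial ℤ_[ℓ]) (hf : IsDistinguishedAt ℓ f) :
    red ℓ (f : Lam ℓ) = PowerSeries.X ^ f.natDegree := by
  ext i
  rw [PowerSeries.coeff_X_pow, red, PowerSeries.coeff_map, Polynomial.coeff_coe]
  rcases lt_trichotomy i f.natDegree with h | h | h
  · rw [if_neg h.ne]
    have := hf.2 i h
    rwa [← PadicInt.maximalIdeal_eq_span_p, ← PadicInt.ker_toZMod] at this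
  · rw [if_pos h, h, hf.1.coeff_natDegree, map_one]
  · rw [if_neg h.ne', Polynomial.coeff_eq_zero_of_natDegree_lt h, map_zero]

theorem not_dvd_dist (f : Polynomial ℤ_[ℓ]) (hf : IsDistinguishedAt ℓ f) :
    ¬ (ℓ : Lam ℓ) ∣ (f : Lam ℓ) := by
  rw [dvd_iff, red_dist f hf]
  exact pow_ne_zero _ PowerSeries.X_ne_zero

/-- the maximal ideal `(ℓ, T)` -/
noncomputable def mI (ℓ : ℕ) [Fact ℓ.Prime] : Ideal (Lam ℓ) :=
  Ideal.span {(ℓ : Lam ℓ), PowerSeries.X}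

theorem ell_mem : (ℓ : Lam ℓ) ∈ mI ℓ := Ideal.subset_span (by simp)
theorem X_mem : (PowerSeries.X : Lam ℓ) ∈ mI ℓ := Ideal.subset_span (by simp)

theorem mI_le : mI ℓ ≤ Ideal.jacobson ⊥ := by
  rw [IsLocalRing.jacobson_eq_maximalIdeal _ bot_ne_top, mI, Ideal.span_le]
  rintro x (rfl | rfl)
  · exact prime_ell.not_isUnit
  · exact PowerSeries.X_prime.not_isUnit

theorem omega_succ_s13 (n : ℕ) : ∃ c : Lam ℓ,
    omegaIw ℓ (n + 1) = omegaIw ℓ n * (ℓ + omegaIw ℓ n * c) := by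
  obtain ⟨c, hc⟩ := Polynomial.powAddExpansion (1 : Lam ℓ) (omegaIw ℓ n) ℓ
  refine ⟨c, ?_⟩
  have : omegaIw ℓ (n + 1) = (1 + omegaIw ℓ n) ^ ℓ - 1 := by
    simp [omegaIw, pow_succ, pow_mul]
  rw [this, hc]
  simp
  ring

theorem omega_mem (n : ℕ) : omegaIw ℓ n ∈ mI ℓ ^ (n + 1) := by
  induction n with
  | zero => simpa [omegaIw] using X_mem
  | succ n ih =>
    obtain ⟨c, hc⟩ := omega_succ_s13 (ℓ := ℓ) n
    rw [hc, pow_succ]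
    refine Ideal.mul_mem_mul ih (Ideal.add_mem _ ell_mem (Ideal.mul_mem_right _ _ ?_))
    exact Ideal.pow_le_self (Nat.succ_ne_zero n) ih

theorem exists_pow_kill (F : Type) [AddCommGroup F] [Module (Lam ℓ) F] [Finite F] :
    ∃ k : ℕ, ∀ n ≥ k, ∀ r ∈ mI ℓ ^ n, ∀ x : F, r • x = 0 := by
  let s : ℕ →o (Submodule (Lam ℓ) F)ᵒᵈ :=
    ⟨fun n => OrderDual.toDual (mI ℓ ^ n • (⊤ : Submodule (Lam ℓ) F)), fun a b h =>
      OrderDual.toDual_le_toDual.2 (Submodule.smul_mono_left (Ideal.pow_le_pow_right h))⟩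
  obtain ⟨k, hk⟩ := IsArtinian.monotone_stabilizes s
  have h1 : mI ℓ ^ k • (⊤ : Submodule (Lam ℓ) F) = mI ℓ ^ (k + 1) • ⊤ :=
    hk (k + 1) (Nat.le_succ k)
  have h2 : mI ℓ ^ k • (⊤ : Submodule (Lam ℓ) F) = ⊥ := by
    apply Submodule.eq_bot_of_le_smul_of_le_jacobson_bot (mI ℓ) _ (IsNoetherian.noetherian _)
      _ mI_le
    rw [← Submodule.mul_smul, ← pow_succ', ← h1]
  refine ⟨k, fun n hn r hr x => ?_⟩
  have := Submodule.smul_mem_smul (Ideal.pow_le_pow_right hn hr)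
    (Submodule.mem_top (R := Lam ℓ) (x := x))
  rw [h2] at this
  simpa using this

theorem omega_mem_dist (f : Polynomial ℤ_[ℓ]) (hf : IsDistinguishedAt ℓ f) (k : ℕ) :
    ∃ N, ∀ n ≥ N, ∃ a b : Lam ℓ, omegaIw ℓ n = a * (f : Lam ℓ) + b * (ℓ : Lam ℓ) ^ k := by
  have hl : (ℓ : Lam ℓ) ∈ (Ideal.span {(f : Lam ℓ), (ℓ : Lam ℓ) ^ k}).radical :=
    ⟨k, Ideal.subset_span (by simp)⟩
  have hff : (f : Lam ℓ) ∈ (Ideal.span {(f : Lam ℓ), (ℓ : Lam ℓ) ^ k}).radical :=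
    Ideal.le_radical (Ideal.subset_span (by simp))
  have hle : mI ℓ ≤ (Ideal.span {(f : Lam ℓ), (ℓ : Lam ℓ) ^ k}).radical := by
    rw [mI, Ideal.span_le]
    rintro x (rfl | rfl)
    · exact hl
    · have h1 : (ℓ : Lam ℓ) ∣ (f : Lam ℓ) - PowerSeries.X ^ f.natDegree := by
        rw [dvd_iff, map_sub, red_dist f hf, map_pow]
        simp [red]
      obtain ⟨c, hc⟩ := h1
      have h2 : (PowerSeries.X : Lam ℓ) ^ f.natDegree
          ∈ (Ideal.span {(f : Lam ℓ), (ℓ : Lam ℓ) ^ k}).radical := by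
        have : (PowerSeries.X : Lam ℓ) ^ f.natDegree = f - ℓ * c := by rw [← hc]; ring
        rw [this]
        exact Ideal.sub_mem _ hff (Ideal.mul_mem_right _ _ hl)
      exact (Ideal.radical_isRadical _) ⟨_, h2⟩
  obtain ⟨N, hN⟩ := Ideal.exists_pow_le_of_le_radical_of_fg hle
    (Submodule.fg_span (Set.toFinite _))
  refine ⟨N, fun n hn => ?_⟩
  have := hN (Ideal.pow_le_pow_right (by omega : N ≤ n + 1) (omega_mem n))
  rw [Ideal.mem_span_pair] at this
  obtain ⟨a, b, h⟩ := this
  exact ⟨a, b, h.symm⟩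

/-- The image in `F × F` of the relations `ℓ^(n+1) x + ω_n y = 0`. -/
noncomputable def S {M F : Type} [AddCommGroup M] [Module (Lam ℓ) M] [AddCommGroup F]
    [Module (Lam ℓ) F] (φ : M →ₗ[Lam ℓ] F) (n : ℕ) : Submodule (Lam ℓ) (F × F) :=
  (LinearMap.ker (((ℓ : Lam ℓ) ^ (n + 1)) • LinearMap.fst (Lam ℓ) M M
    + (omegaIw ℓ n) • LinearMap.snd (Lam ℓ) M M)).map (φ.prodMap φ)

theorem mem_S {M F : Type} [AddCommGroup M] [Module (Lam ℓ) M] [AddCommGroup F]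
    [Module (Lam ℓ) F] (φ : M →ₗ[Lam ℓ] F) (n : ℕ) (z : F × F) :
    z ∈ S φ n ↔ ∃ x y : M, (ℓ : Lam ℓ) ^ (n + 1) • x + omegaIw ℓ n • y = 0 ∧
      (φ x, φ y) = z := by
  simp [S, Submodule.mem_map]

/-- the stationarity property -/
def P (ℓ : ℕ) [Fact ℓ.Prime] (M : Type) [AddCommGroup M] [Module (Lam ℓ) M] : Prop :=
  ∀ (F : Type) [AddCommGroup F] [Module (Lam ℓ) F] [Finite F] (φ : M →ₗ[Lam ℓ] F),
    ∃ Z : Submodule (Lam ℓ) (F × F), ∀ᶠ n in atTop, S φ n = Z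

theorem P_pi {ι : Type} [Fintype ι] (M : ι → Type) [∀ i, AddCommGroup (M i)]
    [∀ i, Module (Lam ℓ) (M i)] (h : ∀ i, P ℓ (M i)) : P ℓ (∀ i, M i) := by
  classical
  intro F _ _ _ φ
  choose Z hZ using fun i => h i F (φ ∘ₗ LinearMap.single (Lam ℓ) M i)
  refine ⟨⨆ i, Z i, ?_⟩
  filter_upwards [eventually_all.2 hZ] with n hn
  simp_rw [← hn]
  apply le_antisymm
  · intro z hz
    obtain ⟨x, y, hxy, rfl⟩ := (mem_S _ _ _).1 hz
    have h1 : (φ x, φ y) = ∑ i, (φ (Pi.single i (x i)), φ (Pi.single i (y i))) := by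
      apply Prod.ext
      · rw [Prod.fst_sum, ← map_sum, Finset.univ_sum_single]
      · rw [Prod.snd_sum, ← map_sum, Finset.univ_sum_single]
    rw [h1]
    refine Submodule.sum_mem _ fun i _ => Submodule.mem_iSup_of_mem i ?_
    exact (mem_S _ _ _).2 ⟨x i, y i, congrFun hxy i, rfl⟩
  · refine iSup_le fun i z hz => ?_
    obtain ⟨x, y, hxy, rfl⟩ := (mem_S _ _ _).1 hz
    refine (mem_S _ _ _).2 ⟨Pi.single i x, Pi.single i y, ?_, rfl⟩
    rw [← Pi.single_smul, ← Pi.single_smul, ← Pi.single_add, hxy, Pi.single_zero]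

theorem P_prod {M N : Type} [AddCommGroup M] [Module (Lam ℓ) M] [AddCommGroup N]
    [Module (Lam ℓ) N] (hM : P ℓ M) (hN : P ℓ N) : P ℓ (M × N) := by
  intro F _ _ _ φ
  obtain ⟨Z, hZ⟩ := hM F (φ ∘ₗ LinearMap.inl (Lam ℓ) M N)
  obtain ⟨W, hW⟩ := hN F (φ ∘ₗ LinearMap.inr (Lam ℓ) M N)
  refine ⟨Z ⊔ W, ?_⟩
  filter_upwards [hZ, hW] with n h1 h2
  rw [← h1, ← h2]
  apply le_antisymm
  · intro z hz
    obtain ⟨⟨x, x'⟩, ⟨y, y'⟩, hxy, rfl⟩ := (mem_S _ _ _).1 hz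
    have hx : φ (x, x') = φ (x, 0) + φ (0, x') := by rw [← map_add]; simp
    have hy : φ (y, y') = φ (y, 0) + φ (0, y') := by rw [← map_add]; simp
    rw [hx, hy, ← Prod.mk_add_mk]
    exact Submodule.add_mem_sup
      ((mem_S _ _ _).2 ⟨x, y, congrArg Prod.fst hxy, rfl⟩)
      ((mem_S _ _ _).2 ⟨x', y', congrArg Prod.snd hxy, rfl⟩)
  · refine sup_le ?_ ?_
    · intro z hz
      obtain ⟨x, y, hxy, rfl⟩ := (mem_S _ _ _).1 hz
      refine (mem_S _ _ _).2 ⟨(x, 0), (y, 0), ?_, rfl⟩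
      simpa using hxy
    · intro z hz
      obtain ⟨x, y, hxy, rfl⟩ := (mem_S _ _ _).1 hz
      refine (mem_S _ _ _).2 ⟨(0, x), (0, y), ?_, rfl⟩
      simpa using hxy

theorem P_equiv {M N : Type} [AddCommGroup M] [Module (Lam ℓ) M] [AddCommGroup N]
    [Module (Lam ℓ) N] (e : M ≃ₗ[Lam ℓ] N) (hN : P ℓ N) : P ℓ M := by
  intro F _ _ _ φ
  obtain ⟨Z, hZ⟩ := hN F (φ ∘ₗ e.symm.toLinearMap)
  refine ⟨Z, ?_⟩
  filter_upwards [hZ] with n h1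
  rw [← h1]
  ext z
  rw [mem_S, mem_S]
  constructor
  · rintro ⟨x, y, h, rfl⟩
    refine ⟨e x, e y, ?_, by simp⟩
    rw [← map_smul, ← map_smul, ← map_add, h, map_zero]
  · rintro ⟨x, y, h, rfl⟩
    refine ⟨e.symm x, e.symm y, ?_, by simp⟩
    rw [← map_smul, ← map_smul, ← map_add, h, map_zero]

theorem P_free : P ℓ (Lam ℓ) := by
  intro F _ _ _ φ
  obtain ⟨k, hk⟩ := exists_pow_kill (ℓ := ℓ) F
  refine ⟨⊥, ?_⟩
  filter_upwards [eventually_ge_atTop k] with n hn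
  rw [eq_bot_iff]
  intro z hz
  obtain ⟨x, y, hxy, rfl⟩ := (mem_S _ _ _).1 hz
  simp only [smul_eq_mul] at hxy
  have h1 : (ℓ : Lam ℓ) ^ (n + 1) ∣ omegaIw ℓ n * y := ⟨-x, by linear_combination hxy⟩
  obtain ⟨c, rfl⟩ := prime_ell.pow_dvd_of_dvd_mul_left _ (not_dvd_omega n) h1
  have hx : x = omegaIw ℓ n * (-c) := by
    have : (ℓ : Lam ℓ) ^ (n + 1) * x = (ℓ : Lam ℓ) ^ (n + 1) * (omegaIw ℓ n * (-c)) := by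
      linear_combination hxy
    exact mul_left_cancel₀ (pow_ne_zero _ ell_ne_zero) this
  rw [hx, ← smul_eq_mul, ← smul_eq_mul, map_smul, map_smul,
    hk (n + 1) (by omega) _ (omega_mem n), hk (n + 1) (by omega) _ (Ideal.pow_mem_pow ell_mem _)]
  simp

theorem P_mu (m : ℕ) : P ℓ (Lam ℓ ⧸ Ideal.span {(ℓ : Lam ℓ) ^ m}) := by
  intro F _ _ _ φ
  refine ⟨(LinearMap.range φ).prod ⊥, ?_⟩
  filter_upwards [eventually_ge_atTop m] with n hn
  have h0 : ∀ x : Lam ℓ ⧸ Ideal.span {(ℓ : Lam ℓ) ^ m}, (ℓ : Lam ℓ) ^ (n + 1) • x = 0 := by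
    intro x
    obtain ⟨x, rfl⟩ := Ideal.Quotient.mk_surjective x
    rw [← Ideal.Quotient.mk_eq_mk, ← Submodule.Quotient.mk_smul, Submodule.Quotient.mk_eq_zero,
      Ideal.mem_span_singleton, smul_eq_mul]
    exact (pow_dvd_pow _ (by omega)).mul_right _
  ext ⟨z, w⟩
  rw [mem_S]
  constructor
  · rintro ⟨x, y, h, h'⟩
    rw [h0, zero_add] at h
    have hy : y = 0 := by
      obtain ⟨y, rfl⟩ := Ideal.Quotient.mk_surjective y
      rw [← Ideal.Quotient.mk_eq_mk] at h ⊢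
      rw [← Submodule.Quotient.mk_smul, Submodule.Quotient.mk_eq_zero,
        Ideal.mem_span_singleton, smul_eq_mul] at h
      rw [Submodule.Quotient.mk_eq_zero, Ideal.mem_span_singleton]
      exact prime_ell.pow_dvd_of_dvd_mul_left _ (not_dvd_omega n) h
    rw [← h', hy]
    simp [Submodule.mem_prod]
  · rintro ⟨⟨x, hx⟩, hw⟩
    refine ⟨x, 0, by rw [h0]; simp, ?_⟩
    have : w = 0 := by simpa using hw
    rw [this, map_zero]
    exact Prod.ext hx rfl

theorem P_lambda (f : Polynomial ℤ_[ℓ]) (hf : IsDistinguishedAt ℓ f) :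
    P ℓ (Lam ℓ ⧸ Ideal.span {(f : Lam ℓ)}) := by
  intro F _ _ _ φ
  obtain ⟨k, hk⟩ := exists_pow_kill (ℓ := ℓ) F
  obtain ⟨N, hN⟩ := omega_mem_dist f hf (k + 2)
  have htf : ∀ x : Lam ℓ ⧸ Ideal.span {(f : Lam ℓ)}, (ℓ : Lam ℓ) • x = 0 → x = 0 := by
    intro x h
    obtain ⟨x, rfl⟩ := Ideal.Quotient.mk_surjective x
    rw [← Ideal.Quotient.mk_eq_mk] at h ⊢
    rw [← Submodule.Quotient.mk_smul, Submodule.Quotient.mk_eq_zero,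
        Ideal.mem_span_singleton, smul_eq_mul] at h
    rw [Submodule.Quotient.mk_eq_zero, Ideal.mem_span_singleton]
    obtain ⟨c, hc⟩ := h
    obtain ⟨d, rfl⟩ := (prime_ell.dvd_or_dvd ⟨x, hc.symm⟩).resolve_left (not_dvd_dist f hf)
    exact ⟨d, mul_left_cancel₀ ell_ne_zero (by rw [hc]; ring)⟩
  have hfx : ∀ x : Lam ℓ ⧸ Ideal.span {(f : Lam ℓ)}, (f : Lam ℓ) • x = 0 := by
    intro x
    obtain ⟨x, rfl⟩ := Ideal.Quotient.mk_surjective x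
    rw [← Ideal.Quotient.mk_eq_mk, ← Submodule.Quotient.mk_smul, Submodule.Quotient.mk_eq_zero,
      Ideal.mem_span_singleton, smul_eq_mul]
    exact dvd_mul_right _ _
  have step : ∀ n ≥ N, S φ (n + 1) = S φ n := by
    intro n hn
    obtain ⟨a, b, hab⟩ := hN n hn
    obtain ⟨c, hc⟩ := omega_succ_s13 (ℓ := ℓ) n
    have hnu : (ℓ : Lam ℓ) + omegaIw ℓ n * c
        = ℓ * (1 + (ℓ : Lam ℓ) ^ (k + 1) * (b * c)) + a * c * f := by
      rw [hab]; ring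
    have hmem : (ℓ : Lam ℓ) ^ (k + 1) * (b * c) ∈ mI ℓ ^ (k + 1) :=
      Ideal.mul_mem_right _ _ (Ideal.pow_mem_pow ell_mem _)
    have hunit : IsUnit (1 + (ℓ : Lam ℓ) ^ (k + 1) * (b * c)) := by
      have := Ideal.mem_jacobson_bot.1 (mI_le (Ideal.pow_le_self (Nat.succ_ne_zero k) hmem)) 1
      rwa [mul_one, add_comm] at this
    obtain ⟨u, hu⟩ := hunit
    have hrel : ∀ x y : Lam ℓ ⧸ Ideal.span {(f : Lam ℓ)},
        (ℓ : Lam ℓ) ^ (n + 1 + 1) • x + omegaIw ℓ (n + 1) • y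
          = (ℓ : Lam ℓ) • ((ℓ : Lam ℓ) ^ (n + 1) • x + omegaIw ℓ n • ((u : Lam ℓ) • y)) := by
      intro x y
      have h1 : omegaIw ℓ (n + 1) • y = ((ℓ : Lam ℓ) * (omegaIw ℓ n * u)) • y := by
        have : omegaIw ℓ (n + 1) = ℓ * (omegaIw ℓ n * u) + (omegaIw ℓ n * a * c) * f := by
          rw [hc, hnu, hu]; ring
        rw [this, add_smul, mul_smul (omegaIw ℓ n * a * c), hfx, smul_zero, add_zero]
      rw [h1, smul_add, smul_smul, smul_smul, smul_smul, pow_succ' _ (n + 1), mul_assoc]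
    have hφ : ∀ y, φ ((u : Lam ℓ) • y) = φ y := by
      intro y
      rw [map_smul, hu, add_smul, one_smul, hk (k + 1) (Nat.le_succ k) _ hmem, add_zero]
    ext z
    rw [mem_S, mem_S]
    constructor
    · rintro ⟨x, y, h, rfl⟩
      rw [hrel] at h
      exact ⟨x, (u : Lam ℓ) • y, htf _ h, by rw [hφ]⟩
    · rintro ⟨x, y, h, rfl⟩
      have huy : (u : Lam ℓ) • (((u⁻¹ : (Lam ℓ)ˣ) : Lam ℓ) • y) = y := by
        rw [smul_smul, Units.mul_inv, one_smul]
      refine ⟨x, ((u⁻¹ : (Lam ℓ)ˣ) : Lam ℓ) • y, ?_, ?_⟩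
      · rw [hrel, huy, h, smul_zero]
      · rw [← hφ (_ • y), huy]
  refine ⟨S φ N, ?_⟩
  filter_upwards [eventually_ge_atTop N] with n hn
  induction n, hn using Nat.le_induction with
  | base => rfl
  | succ n hn ih => rw [step n hn, ih]

theorem mem_nabla {M : Type*} [AddCommGroup M] [Module (Lam ℓ) M] (n : ℕ)
    (N : Submodule (Lam ℓ) M) (z : M) : z ∈ nablaN ℓ n N ↔
      ∃ x ∈ N, ∃ y ∈ N, (ℓ : Lam ℓ) ^ (n + 1) • x + omegaIw ℓ n • y = z := by
  rw [nablaN, Submodule.ideal_span_singleton_smul, Submodule.ideal_span_singleton_smul,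
    Submodule.mem_sup]
  simp [Submodule.mem_smul_pointwise_iff_exists]

theorem card_eq {E : Type} [AddCommGroup E] [Module (Lam ℓ) E] (X : Submodule (Lam ℓ) E)
    (n : ℕ) : Nat.card
        (↥(nablaN ℓ n (⊤ : Submodule (Lam ℓ) E)) ⧸
          Submodule.comap (nablaN ℓ n (⊤ : Submodule (Lam ℓ) E)).subtype
            (nablaN ℓ n X)) =
      Nat.card ((E × E) ⧸ (S X.mkQ n).comap (X.mkQ.prodMap X.mkQ)) := by
  let g0 : E × E →ₗ[Lam ℓ] E := ((ℓ : Lam ℓ) ^ (n + 1)) • LinearMap.fst (Lam ℓ) E E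
    + (omegaIw ℓ n) • LinearMap.snd (Lam ℓ) E E
  have hg0 : ∀ p, g0 p = (ℓ : Lam ℓ) ^ (n + 1) • p.1 + omegaIw ℓ n • p.2 := fun p => rfl
  let g1 : E × E →ₗ[Lam ℓ] ↥(nablaN ℓ n (⊤ : Submodule (Lam ℓ) E)) :=
    g0.codRestrict _ fun p => (mem_nabla _ _ _).2 ⟨p.1, trivial, p.2, trivial, rfl⟩
  let g := (Submodule.comap (nablaN ℓ n (⊤ : Submodule (Lam ℓ) E)).subtype
            (nablaN ℓ n X)).mkQ ∘ₗ g1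
  have hs : Function.Surjective g := by
    refine (Submodule.mkQ_surjective _).comp ?_
    rintro ⟨z, hz⟩
    obtain ⟨x, -, y, -, h⟩ := (mem_nabla _ _ _).1 hz
    exact ⟨(x, y), Subtype.ext h⟩
  have hk : LinearMap.ker g = (S X.mkQ n).comap (X.mkQ.prodMap X.mkQ) := by
    ext ⟨x, y⟩
    have h1 : (x, y) ∈ LinearMap.ker g ↔ g0 (x, y) ∈ nablaN ℓ n X := by
      rw [LinearMap.mem_ker]
      exact Submodule.Quotient.mk_eq_zero _
    rw [h1, mem_nabla, Submodule.mem_comap, mem_S, hg0]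
    constructor
    · rintro ⟨x', hx, y', hy, h⟩
      refine ⟨x - x', y - y', ?_, ?_⟩
      · rw [smul_sub, smul_sub, ← sub_eq_zero.2 h.symm]
        abel
      · have hx0 : X.mkQ x' = 0 := (Submodule.Quotient.mk_eq_zero _).2 hx
        have hy0 : X.mkQ y' = 0 := (Submodule.Quotient.mk_eq_zero _).2 hy
        rw [map_sub, map_sub, hx0, hy0, sub_zero, sub_zero]
        rfl
    · rintro ⟨x', y', h, h'⟩
      have hx : X.mkQ x' = X.mkQ x := congrArg Prod.fst h'
      have hy : X.mkQ y' = X.mkQ y := congrArg Prod.snd h'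
      refine ⟨x - x', (Submodule.Quotient.eq _).1 hx.symm, y - y',
        (Submodule.Quotient.eq _).1 hy.symm, ?_⟩
      rw [smul_sub, smul_sub, ← sub_zero (_ + omegaIw ℓ n • (x, y).2), ← h]
      abel
  rw [← hk]
  exact (Nat.card_congr (g.quotKerEquivOfSurjective hs).toEquiv).symm

end NablaAux

/-- For an elementary `Λ`-module `E` and a submodule `X ⊆ E` of finite index, the indices
`(∇_nE : ∇_nX)` are eventually constant. -/
theorem elementary_submodule_nabla_index_stationary (ℓ : ℕ) [Fact ℓ.Prime]
    (ρ : ℕ) (ι κ : Type) [Fintype ι] [Fintype κ]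
    (f : ι → Polynomial ℤ_[ℓ]) (hf : ∀ i, IsDistinguishedAt ℓ (f i))
    (m : κ → ℕ) (hm : ∀ j, 0 < m j)
    (E : Type) [AddCommGroup E] [Module (Lam ℓ) E]
    (e : E ≃ₗ[Lam ℓ] ElemMod ℓ ρ f m)
    (X : Submodule (Lam ℓ) E) (hX : Finite (E ⧸ X)) :
    ∃ n₀ c : ℕ, ∀ n ≥ n₀,
      Nat.card
        (↥(nablaN ℓ n (⊤ : Submodule (Lam ℓ) E)) ⧸
          Submodule.comap (nablaN ℓ n (⊤ : Submodule (Lam ℓ) E)).subtype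
            (nablaN ℓ n X)) = c := by
  have hP : NablaAux.P ℓ E := NablaAux.P_equiv e
    (NablaAux.P_prod (NablaAux.P_pi _ fun _ => NablaAux.P_free)
      (NablaAux.P_prod (NablaAux.P_pi _ fun i => NablaAux.P_lambda (f i) (hf i))
        (NablaAux.P_pi _ fun j => NablaAux.P_mu (m j))))
  obtain ⟨Z, hZ⟩ := hP (E ⧸ X) X.mkQ
  obtain ⟨n₀, hn⟩ := Filter.eventually_atTop.1 hZ
  refine ⟨n₀, Nat.card ((E × E) ⧸ Z.comap (X.mkQ.prodMap X.mkQ)), fun n h => ?_⟩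
  rw [NablaAux.card_eq, hn n h]
end

section
/- Let X be a finitely generated Λ-module (Λ = ℤ_ℓ[[T]]) and let t : X → E be a pseudo-isomorphism onto an elementary Λ-module E (i.e., a Λ-morphism with finite kernel and cokernel). Then the sequence of ratios (X : ∇_nX)/(E : ∇_nE) of the (finite) indices is eventually constant as n → ∞, where ∇_nM = ℓ^{n+1}M + ω_nM, ω_n = (1+T)^{ℓ^n} − 1. -/
namespace IwAux

/-- The ideal `(ℓ, T)` of `Λ`. -/
noncomputable def mIw (ℓ : ℕ) [Fact ℓ.Prime] : Ideal (Lam ℓ) :=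
  Ideal.span {(ℓ : Lam ℓ)} ⊔ Ideal.span {(PowerSeries.X : Lam ℓ)}

variable (ℓ : ℕ) [Fact ℓ.Prime]

theorem ell_mem : (ℓ : Lam ℓ) ∈ mIw ℓ :=
  (le_sup_left : _ ≤ mIw ℓ) (Ideal.mem_span_singleton_self _)

theorem X_mem : (PowerSeries.X : Lam ℓ) ∈ mIw ℓ :=
  (le_sup_right : _ ≤ mIw ℓ) (Ideal.mem_span_singleton_self _)

theorem dvd_iff_map (x : Lam ℓ) :
    (ℓ : Lam ℓ) ∣ x ↔ PowerSeries.map (PadicInt.toZMod (p := ℓ)) x = 0 := by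
  constructor
  · rintro ⟨y, rfl⟩
    rw [map_mul, map_natCast]
    have h : ((ℓ : ℕ) : PowerSeries (ZMod ℓ)) = 0 := by
      rw [← map_natCast (PowerSeries.C (R := ZMod ℓ)) ℓ]
      simp
    rw [h, zero_mul]
  · intro h
    have h1 : ∀ i, ∃ c, PowerSeries.coeff i x = (ℓ : ℤ_[ℓ]) * c := by
      intro i
      have h2 : PowerSeries.coeff i x ∈ RingHom.ker (PadicInt.toZMod (p := ℓ)) := by
        rw [RingHom.mem_ker, ← PowerSeries.coeff_map, h]
        simp
      rw [PadicInt.ker_toZMod, PadicInt.maximalIdeal_eq_span_p,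
        Ideal.mem_span_singleton] at h2
      exact h2
    choose c hc using h1
    refine ⟨PowerSeries.mk c, ?_⟩
    ext i
    rw [← map_natCast (PowerSeries.C (R := ℤ_[ℓ])) ℓ, PowerSeries.coeff_C_mul,
      PowerSeries.coeff_mk, hc]

theorem ell_ne : (ℓ : Lam ℓ) ≠ 0 := by
  rw [← map_natCast (PowerSeries.C (R := ℤ_[ℓ])) ℓ]
  intro h
  have := (map_eq_zero_iff _ PowerSeries.C_injective).1 h
  exact (Fact.out : ℓ.Prime).ne_zero (by exact_mod_cast this)

theorem ell_prime : Prime (ℓ : Lam ℓ) := by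
  refine ⟨ell_ne ℓ, ?_, ?_⟩
  · intro h
    have h1 := (dvd_iff_map ℓ 1).1 (h.dvd)
    rw [map_one] at h1
    exact one_ne_zero h1
  · intro a b h
    rw [dvd_iff_map, map_mul, mul_eq_zero] at h
    rwa [dvd_iff_map, dvd_iff_map]

theorem not_dvd_omega (n : ℕ) : ¬ (ℓ : Lam ℓ) ∣ omegaIw ℓ n := by
  rw [dvd_iff_map]
  have : CharP (PowerSeries (ZMod ℓ)) ℓ :=
    charP_of_injective_ringHom (f := PowerSeries.C (R := ZMod ℓ)) PowerSeries.C_injective ℓ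
  unfold omegaIw
  rw [map_sub, map_pow, map_add, map_one, PowerSeries.map_X, add_pow_char_pow]
  simp

theorem not_dvd_monic (f : Polynomial ℤ_[ℓ]) (hf : f.Monic) : ¬ (ℓ : Lam ℓ) ∣ (f : Lam ℓ) := by
  rw [dvd_iff_map]
  intro h
  have := congrArg (PowerSeries.coeff f.natDegree) h
  rw [PowerSeries.coeff_map, Polynomial.coeff_coe, hf.coeff_natDegree] at this
  simp at this

theorem omega_succ (n : ℕ) :
    ∃ s, omegaIw ℓ (n + 1) = omegaIw ℓ n * ((ℓ : Lam ℓ) + omegaIw ℓ n * s) := by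
  have h : omegaIw ℓ (n + 1) = (omegaIw ℓ n + 1) ^ ℓ - 1 := by
    unfold omegaIw
    rw [pow_succ, pow_mul, sub_add_cancel]
  obtain ⟨s, hs⟩ : ∃ s, (omegaIw ℓ n + 1) ^ ℓ =
      1 + (ℓ : Lam ℓ) * omegaIw ℓ n + omegaIw ℓ n ^ 2 * s := by
    generalize omegaIw ℓ n = w
    suffices H : ∀ k : ℕ, ∃ s, (w + 1) ^ k = 1 + (k : Lam ℓ) * w + w ^ 2 * s from H ℓ
    intro k
    induction k with
    | zero => exact ⟨0, by simp⟩
    | succ k ih =>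
      obtain ⟨s, hs⟩ := ih
      refine ⟨s * (w + 1) + k, ?_⟩
      rw [pow_succ, hs]
      push_cast
      ring
  exact ⟨s, by rw [h, hs]; ring⟩

theorem omega_mem (n : ℕ) : omegaIw ℓ n ∈ mIw ℓ ^ (n + 1) := by
  induction n with
  | zero => simpa [omegaIw] using X_mem ℓ
  | succ n ih =>
    obtain ⟨s, hs⟩ := omega_succ ℓ n
    rw [hs, pow_succ _ (n + 1)]
    refine Ideal.mul_mem_mul ih (Ideal.add_mem _ (ell_mem ℓ) (Ideal.mul_mem_right _ _ ?_))
    exact Ideal.pow_le_self (Nat.succ_ne_zero n) ih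

theorem sup_pow_le {R : Type*} [CommRing R] (I J : Ideal R) (n : ℕ) :
    (I ⊔ J) ^ (n + 1) ≤ I * (I ⊔ J) ^ n ⊔ J ^ (n + 1) := by
  induction n with
  | zero => simp
  | succ n ih =>
    rw [pow_succ (I ⊔ J) (n + 1), mul_comm, Ideal.sup_mul]
    refine sup_le le_sup_left ?_
    refine (Ideal.mul_mono_right ih).trans ?_
    rw [Ideal.mul_sup]
    refine sup_le (le_trans ?_ le_sup_left) (le_trans ?_ le_sup_right)
    · rw [mul_left_comm, pow_succ' (I ⊔ J) n]
      exact Ideal.mul_mono_right (Ideal.mul_mono_left le_sup_right)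
    · rw [pow_succ' J (n + 1)]

/-- In `Λ/f`, high powers of `(ℓ,T)` are in `ℓ (ℓ,T)^k`. -/
theorem pow_mem_f (f : Polynomial ℤ_[ℓ]) (hf : IsDistinguishedAt ℓ f) (k n : ℕ)
    (hn : f.natDegree + k ≤ n) (x : Lam ℓ) (hx : x ∈ mIw ℓ ^ (n + 1)) :
    ∃ y ∈ mIw ℓ ^ k, ∃ c, x = (ℓ : Lam ℓ) * y + (f : Lam ℓ) * c := by
  obtain ⟨g, hg⟩ : ∃ g : Lam ℓ, (f : Lam ℓ) = PowerSeries.X ^ f.natDegree + (ℓ : Lam ℓ) * g := by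
    have : (ℓ : Lam ℓ) ∣ (f : Lam ℓ) - PowerSeries.X ^ f.natDegree := by
      rw [dvd_iff_map]
      ext i
      rw [PowerSeries.coeff_map, map_sub, Polynomial.coeff_coe, PowerSeries.coeff_X_pow]
      rcases lt_trichotomy i f.natDegree with h | h | h
      · have h1 := hf.2 i h
        rw [← PadicInt.maximalIdeal_eq_span_p, ← PadicInt.ker_toZMod, RingHom.mem_ker] at h1
        rw [if_neg h.ne, sub_zero, h1, map_zero]
      · rw [if_pos h, h, hf.1.coeff_natDegree]; simp
      · rw [if_neg h.ne', Polynomial.coeff_eq_zero_of_natDegree_lt h]; simp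
    obtain ⟨g, hg⟩ := this
    exact ⟨g, by rw [← hg]; ring⟩
  have h1 := sup_pow_le _ _ n hx
  obtain ⟨u, hu, v, hv, rfl⟩ := Submodule.mem_sup.1 h1
  rw [Ideal.mem_span_singleton_mul] at hu
  rw [Ideal.span_singleton_pow, Ideal.mem_span_singleton] at hv
  obtain ⟨u, hu, rfl⟩ := hu
  obtain ⟨v, rfl⟩ := hv
  have h2 : (PowerSeries.X : Lam ℓ) ^ (n + 1 - f.natDegree) ∈ mIw ℓ ^ k :=
    Ideal.pow_le_pow_right (by omega) (Ideal.pow_mem_pow (X_mem ℓ) _)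
  refine ⟨u - g * (PowerSeries.X ^ (n + 1 - f.natDegree) * v), Ideal.sub_mem _
    (Ideal.pow_le_pow_right (by omega) hu)
    (Ideal.mul_mem_left _ _ (Ideal.mul_mem_right _ _ h2)),
    PowerSeries.X ^ (n + 1 - f.natDegree) * v, ?_⟩
  have h3 : (PowerSeries.X : Lam ℓ) ^ (n + 1) =
      PowerSeries.X ^ f.natDegree * PowerSeries.X ^ (n + 1 - f.natDegree) := by
    rw [← pow_add]; congr 1; omega
  rw [h3, hg]
  ring

/-- Relations shrink, up to `(ℓ,T)^k`. -/
def Shrinks (M : Type*) [AddCommGroup M] [Module (Lam ℓ) M] : Prop :=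
  ∀ k, ∃ n₀, ∀ n ≥ n₀, ∀ a b : M,
    (ℓ : Lam ℓ) ^ (n + 1 + 1) • a + omegaIw ℓ (n + 1) • b = 0 →
    ∃ a' b' : M, (ℓ : Lam ℓ) ^ (n + 1) • a' + omegaIw ℓ n • b' = 0 ∧
      a - a' ∈ mIw ℓ ^ k • (⊤ : Submodule (Lam ℓ) M) ∧
      b - b' ∈ mIw ℓ ^ k • (⊤ : Submodule (Lam ℓ) M)

theorem mem_pow_smul_top {M : Type*} [AddCommGroup M] [Module (Lam ℓ) M] (k : ℕ)
    {r : Lam ℓ} (hr : r ∈ mIw ℓ ^ k) (x : M) :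
    r • x ∈ mIw ℓ ^ k • (⊤ : Submodule (Lam ℓ) M) :=
  Submodule.smul_mem_smul hr Submodule.mem_top

theorem map_pow_smul_top {M N : Type*} [AddCommGroup M] [Module (Lam ℓ) M]
    [AddCommGroup N] [Module (Lam ℓ) N] (g : M →ₗ[Lam ℓ] N) (k : ℕ) {x : M}
    (hx : x ∈ mIw ℓ ^ k • (⊤ : Submodule (Lam ℓ) M)) :
    g x ∈ mIw ℓ ^ k • (⊤ : Submodule (Lam ℓ) N) := by
  have := Submodule.mem_map_of_mem (f := g) hx
  rw [Submodule.map_smul''] at this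
  exact Submodule.smul_mono le_rfl le_top this

theorem shrinks_lam : Shrinks ℓ (Lam ℓ) := by
  intro k
  refine ⟨k, fun n hn a b h => ⟨0, 0, by simp, ?_⟩⟩
  simp only [smul_eq_mul] at h
  have h1 : (ℓ : Lam ℓ) ^ (n + 1 + 1) ∣ omegaIw ℓ (n + 1) * b :=
    ⟨-a, by linear_combination h⟩
  obtain ⟨c, rfl⟩ := (ell_prime ℓ).pow_dvd_of_dvd_mul_left _ (not_dvd_omega ℓ (n + 1)) h1
  have h2 : a = omegaIw ℓ (n + 1) * (-c) := by
    apply mul_left_cancel₀ (pow_ne_zero (n + 1 + 1) (ell_ne ℓ))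
    linear_combination h
  rw [sub_zero, sub_zero, h2]
  have hle : mIw ℓ ^ (n + 1 + 1) ≤ mIw ℓ ^ k := Ideal.pow_le_pow_right (by omega)
  exact ⟨mem_pow_smul_top ℓ k (hle (omega_mem ℓ (n + 1))) _,
    mem_pow_smul_top ℓ k (hle (Ideal.pow_mem_pow (ell_mem ℓ) _)) _⟩

theorem shrinks_pow (m : ℕ) : Shrinks ℓ (Lam ℓ ⧸ Ideal.span {(ℓ : Lam ℓ) ^ m}) := by
  intro k
  refine ⟨m, fun n hn a b h => ⟨a, b, ?_, by simp, by simp⟩⟩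
  have hz : ∀ j ≥ m, ∀ a : Lam ℓ ⧸ Ideal.span {(ℓ : Lam ℓ) ^ m}, (ℓ : Lam ℓ) ^ j • a = 0 := by
    intro j hj a
    obtain ⟨a, rfl⟩ := Ideal.Quotient.mk_surjective a
    rw [← Ideal.Quotient.mk_eq_mk, ← Submodule.Quotient.mk_smul, Submodule.Quotient.mk_eq_zero,
      Ideal.mem_span_singleton]
    exact (pow_dvd_pow _ hj).mul_right _
  rw [hz _ (by omega), zero_add] at h
  rw [hz _ (by omega), zero_add]
  obtain ⟨b, rfl⟩ := Ideal.Quotient.mk_surjective b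
  rw [← Ideal.Quotient.mk_eq_mk, ← Submodule.Quotient.mk_smul, Submodule.Quotient.mk_eq_zero,
    Ideal.mem_span_singleton] at h ⊢
  exact ((ell_prime ℓ).pow_dvd_of_dvd_mul_left _ (not_dvd_omega ℓ (n + 1)) h).mul_left _

theorem shrinks_f (f : Polynomial ℤ_[ℓ]) (hf : IsDistinguishedAt ℓ f) :
    Shrinks ℓ (Lam ℓ ⧸ Ideal.span {(f : Lam ℓ)}) := by
  intro k
  refine ⟨f.natDegree + k, fun n hn a b h => ?_⟩
  obtain ⟨a, rfl⟩ := Ideal.Quotient.mk_surjective a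
  obtain ⟨b, rfl⟩ := Ideal.Quotient.mk_surjective b
  obtain ⟨y, hy, c, hc⟩ := pow_mem_f ℓ f hf k n hn _ (omega_mem ℓ n)
  obtain ⟨s, hs⟩ := omega_succ ℓ n
  rw [← Ideal.Quotient.mk_eq_mk, ← Ideal.Quotient.mk_eq_mk, ← Submodule.Quotient.mk_smul,
    ← Submodule.Quotient.mk_smul, ← Submodule.Quotient.mk_add, Submodule.Quotient.mk_eq_zero,
    Ideal.mem_span_singleton] at h
  obtain ⟨d, hd⟩ := h
  refine ⟨Submodule.Quotient.mk a, Submodule.Quotient.mk ((1 + y * s) * b), ?_, ?_, ?_⟩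
  · rw [← Submodule.Quotient.mk_smul, ← Submodule.Quotient.mk_smul, ← Submodule.Quotient.mk_add,
      Submodule.Quotient.mk_eq_zero, Ideal.mem_span_singleton]
    simp only [smul_eq_mul] at hd ⊢
    have h1 : (ℓ : Lam ℓ) * ((ℓ : Lam ℓ) ^ (n + 1) * a + omegaIw ℓ n * ((1 + y * s) * b)) =
        f * (d - omegaIw ℓ n * c * s * b) := by
      rw [hs] at hd
      linear_combination hd - omegaIw ℓ n * s * b * hc
    have h2 : (ℓ : Lam ℓ) ∣ d - omegaIw ℓ n * c * s * b :=
      ((ell_prime ℓ).dvd_or_dvd ⟨_, h1.symm⟩).resolve_left (not_dvd_monic ℓ f hf.1)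
    obtain ⟨q, hq⟩ := h2
    refine ⟨q, mul_left_cancel₀ (ell_ne ℓ) ?_⟩
    rw [h1, hq]
    ring
  · simp [Ideal.Quotient.mk_eq_mk]
  · rw [← Ideal.Quotient.mk_eq_mk, ← Submodule.Quotient.mk_sub]
    have : b - (1 + y * s) * b = y • (-(s * b)) := by rw [smul_eq_mul]; ring
    rw [this, Submodule.Quotient.mk_smul]
    exact mem_pow_smul_top ℓ k hy _

theorem shrinks_prod {M N : Type*} [AddCommGroup M] [Module (Lam ℓ) M]
    [AddCommGroup N] [Module (Lam ℓ) N] (hM : Shrinks ℓ M) (hN : Shrinks ℓ N) :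
    Shrinks ℓ (M × N) := by
  intro k
  obtain ⟨n1, h1⟩ := hM k
  obtain ⟨n2, h2⟩ := hN k
  refine ⟨max n1 n2, fun n hn a b h => ?_⟩
  obtain ⟨a1, b1, e1, p1, q1⟩ := h1 n (by omega) a.1 b.1 (congrArg Prod.fst h)
  obtain ⟨a2, b2, e2, p2, q2⟩ := h2 n (by omega) a.2 b.2 (congrArg Prod.snd h)
  refine ⟨(a1, a2), (b1, b2), Prod.ext e1 e2, ?_, ?_⟩
  · have := Submodule.add_mem _ (map_pow_smul_top ℓ (LinearMap.inl (Lam ℓ) M N) k p1)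
      (map_pow_smul_top ℓ (LinearMap.inr (Lam ℓ) M N) k p2)
    convert this using 1
    ext <;> simp
  · have := Submodule.add_mem _ (map_pow_smul_top ℓ (LinearMap.inl (Lam ℓ) M N) k q1)
      (map_pow_smul_top ℓ (LinearMap.inr (Lam ℓ) M N) k q2)
    convert this using 1
    ext <;> simp

theorem mem_pi {ι : Type*} [Fintype ι] {M : ι → Type*} [∀ i, AddCommGroup (M i)]
    [∀ i, Module (Lam ℓ) (M i)] (k : ℕ) (x : ∀ i, M i)
    (hx : ∀ i, x i ∈ mIw ℓ ^ k • (⊤ : Submodule (Lam ℓ) (M i))) :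
    x ∈ mIw ℓ ^ k • (⊤ : Submodule (Lam ℓ) (∀ i, M i)) := by
  classical
  rw [← Finset.univ_sum_single x]
  exact Submodule.sum_mem _ fun i _ =>
    map_pow_smul_top ℓ (LinearMap.single (Lam ℓ) M i) k (hx i)

theorem shrinks_pi {ι : Type*} [Fintype ι] {M : ι → Type*} [∀ i, AddCommGroup (M i)]
    [∀ i, Module (Lam ℓ) (M i)] (hM : ∀ i, Shrinks ℓ (M i)) : Shrinks ℓ (∀ i, M i) := by
  intro k
  choose n1 h1 using fun i => hM i k
  refine ⟨Finset.univ.sup n1, fun n hn a b h => ?_⟩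
  choose a1 b1 e1 p1 q1 using fun i => h1 i n
    ((Finset.le_sup (Finset.mem_univ i)).trans hn) (a i) (b i) (congrFun h i)
  exact ⟨a1, b1, funext e1, mem_pi ℓ k _ p1, mem_pi ℓ k _ q1⟩

theorem shrinks_equiv {M N : Type*} [AddCommGroup M] [Module (Lam ℓ) M]
    [AddCommGroup N] [Module (Lam ℓ) N] (e : M ≃ₗ[Lam ℓ] N) (hN : Shrinks ℓ N) :
    Shrinks ℓ M := by
  intro k
  obtain ⟨n1, h1⟩ := hN k
  refine ⟨n1, fun n hn a b h => ?_⟩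
  obtain ⟨a1, b1, e1, p1, q1⟩ := h1 n hn (e a) (e b) (by
    rw [← map_smul, ← map_smul, ← map_add, h, map_zero])
  refine ⟨e.symm a1, e.symm b1, ?_, ?_, ?_⟩
  · rw [← map_smul, ← map_smul, ← map_add, e1, map_zero]
  · have := map_pow_smul_top ℓ e.symm.toLinearMap k p1
    simpa using this
  · have := map_pow_smul_top ℓ e.symm.toLinearMap k q1
    simpa using this

theorem m_le_jac : mIw ℓ ≤ (⊥ : Ideal (Lam ℓ)).jacobson := by
  rw [IsLocalRing.jacobson_eq_maximalIdeal _ bot_ne_top]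
  refine sup_le ?_ ?_ <;> rw [Ideal.span_singleton_le_iff_mem, IsLocalRing.mem_maximalIdeal]
  · exact (ell_prime ℓ).not_isUnit
  · exact PowerSeries.X_prime.not_isUnit

theorem finite_nilp (C : Type*) [AddCommGroup C] [Module (Lam ℓ) C] [Finite C] :
    ∃ k, mIw ℓ ^ k • (⊤ : Submodule (Lam ℓ) C) = ⊥ := by
  have : IsArtinian (Lam ℓ) C := inferInstance
  obtain ⟨k, hk⟩ := IsArtinian.monotone_stabilizes (R := Lam ℓ) (M := C)
    ⟨fun k => OrderDual.toDual (mIw ℓ ^ k • (⊤ : Submodule (Lam ℓ) C)), fun a b hab =>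
      OrderDual.toDual_le_toDual.2 (Submodule.smul_mono_left (Ideal.pow_le_pow_right hab))⟩
  refine ⟨k, ?_⟩
  have h1 : mIw ℓ ^ k • (⊤ : Submodule (Lam ℓ) C) = mIw ℓ ^ (k + 1) • ⊤ := hk (k + 1) (by omega)
  refine Submodule.eq_bot_of_le_smul_of_le_jacobson_bot (mIw ℓ) _ ?_ ?_ (m_le_jac ℓ)
  · exact IsNoetherian.noetherian _
  · rw [← mul_smul, ← pow_succ']
    exact h1.le

theorem finite_coker {E : Type*} [AddCommGroup E] [Module (Lam ℓ) E] (Y : Submodule (Lam ℓ) E)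
    [Finite (E ⧸ Y)] : ∃ k, mIw ℓ ^ k • (⊤ : Submodule (Lam ℓ) E) ≤ Y := by
  obtain ⟨k, hk⟩ := finite_nilp ℓ (E ⧸ Y)
  refine ⟨k, fun x hx => ?_⟩
  have := map_pow_smul_top ℓ Y.mkQ k hx
  rw [hk] at this
  simpa using this

theorem stabilizes (d : ℕ → ℕ) (n₀ B : ℕ) (hd : ∀ n ≥ n₀, d n ≤ d (n + 1)) (hB : ∀ n, d n ≤ B) :
    ∃ n₁, ∀ n ≥ n₁, d n = d n₁ := by
  have hmono : Monotone fun n => d (n₀ + n) :=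
    monotone_nat_of_le_succ fun n => hd _ (by omega)
  obtain ⟨v, ⟨i, rfl⟩, hv⟩ : ∃ v ∈ Set.range (fun n => d (n₀ + n)),
      ∀ w ∈ Set.range (fun n => d (n₀ + n)), w ≤ v := by
    have hfin : (Set.range (fun n => d (n₀ + n))).Finite :=
      (Set.finite_Iic B).subset (by rintro _ ⟨i, rfl⟩; exact hB _)
    obtain ⟨v, hv, h⟩ := hfin.exists_maximal (Set.range_nonempty _)
    exact ⟨v, hv, fun w hw => by
      rcases le_total w v with h' | h'
      · exact h'
      · exact h hw h'⟩
  refine ⟨n₀ + i, fun n hn => le_antisymm ?_ ?_⟩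
  · exact hv _ ⟨n - n₀, by simp only; congr 1; omega⟩
  · have := hmono (show i ≤ n - n₀ by omega)
    simp only at this
    rwa [show n₀ + (n - n₀) = n by omega] at this

/-- `(a,b) ↦ ℓ^(n+1) a + ω_n b`. -/
noncomputable def phi (E : Type*) [AddCommGroup E] [Module (Lam ℓ) E] (n : ℕ) :
    E × E →ₗ[Lam ℓ] E :=
  LinearMap.coprod (((ℓ : Lam ℓ) ^ (n + 1)) • LinearMap.id) (omegaIw ℓ n • LinearMap.id)

theorem nabla_eq_map {E : Type*} [AddCommGroup E] [Module (Lam ℓ) E] (n : ℕ)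
    (Y : Submodule (Lam ℓ) E) : nablaN ℓ n Y = (Y.prod Y).map (phi ℓ E n) := by
  ext x
  unfold nablaN
  rw [Submodule.ideal_span_singleton_smul, Submodule.ideal_span_singleton_smul,
    Submodule.mem_sup]
  simp only [Submodule.mem_smul_pointwise_iff_exists, Submodule.mem_map, Submodule.mem_prod, phi]
  constructor
  · rintro ⟨_, ⟨a, ha, rfl⟩, _, ⟨b, hb, rfl⟩, rfl⟩
    exact ⟨(a, b), ⟨ha, hb⟩, by simp⟩
  · rintro ⟨⟨a, b⟩, ⟨ha, hb⟩, rfl⟩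
    exact ⟨_, ⟨a, ha, rfl⟩, _, ⟨b, hb, rfl⟩, by simp⟩

theorem nabla_anti {E : Type*} [AddCommGroup E] [Module (Lam ℓ) E] (n : ℕ)
    (Y : Submodule (Lam ℓ) E) : nablaN ℓ (n + 1) Y ≤ nablaN ℓ n Y := by
  unfold nablaN
  refine sup_le_sup (Submodule.smul_mono_left ?_) (Submodule.smul_mono_left ?_)
  · exact Ideal.span_singleton_le_span_singleton.2 (pow_dvd_pow _ (by omega))
  · obtain ⟨s, hs⟩ := omega_succ ℓ n
    exact Ideal.span_singleton_le_span_singleton.2 ⟨_, hs⟩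

theorem map_nabla {X E : Type*} [AddCommGroup E] [Module (Lam ℓ) E]
    [AddCommGroup X] [Module (Lam ℓ) X] (t : X →ₗ[Lam ℓ] E) (n : ℕ) (N : Submodule (Lam ℓ) X) :
    (nablaN ℓ n N).map t = nablaN ℓ n (N.map t) := by
  unfold nablaN
  simp only [Submodule.map_smul'', Submodule.map_sup]

/-- Index of `∇_n Y` in `∇_n E` as an index in `E × E`. -/
theorem relIndex_nabla {E : Type*} [AddCommGroup E] [Module (Lam ℓ) E] (n : ℕ)
    (Y : Submodule (Lam ℓ) E) :
    (nablaN ℓ n Y).toAddSubgroup.relIndex (nablaN ℓ n (⊤ : Submodule (Lam ℓ) E)).toAddSubgroup =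
      (Y.prod Y ⊔ LinearMap.ker (phi ℓ E n)).toAddSubgroup.index := by
  rw [← Submodule.comap_map_eq, ← nabla_eq_map]
  have h1 : (Submodule.comap (phi ℓ E n) (nablaN ℓ n Y)).toAddSubgroup =
      (nablaN ℓ n Y).toAddSubgroup.comap (phi ℓ E n).toAddMonoidHom := rfl
  rw [h1, AddSubgroup.index_comap]
  congr 1
  rw [nabla_eq_map, Submodule.prod_top, Submodule.map_top]
  rfl

theorem index_X {X E : Type*} [AddCommGroup E] [Module (Lam ℓ) E]
    [AddCommGroup X] [Module (Lam ℓ) X] (t : X →ₗ[Lam ℓ] E) (n : ℕ) :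
    (nablaN ℓ n (⊤ : Submodule (Lam ℓ) X)).toAddSubgroup.index =
      (nablaN ℓ n (⊤ : Submodule (Lam ℓ) X)).toAddSubgroup.relIndex
        (LinearMap.ker t).toAddSubgroup *
      (nablaN ℓ n (LinearMap.range t)).toAddSubgroup.relIndex
        (LinearMap.range t).toAddSubgroup := by
  have h1 : (nablaN ℓ n (LinearMap.range t)).toAddSubgroup.comap t.toAddMonoidHom =
      (nablaN ℓ n (⊤ : Submodule (Lam ℓ) X)).toAddSubgroup ⊔ (LinearMap.ker t).toAddSubgroup := by
    rw [← Submodule.sup_toAddSubgroup, ← Submodule.comap_map_eq, map_nabla, Submodule.map_top]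
    rfl
  have h2 := AddSubgroup.index_comap (nablaN ℓ n (LinearMap.range t)).toAddSubgroup
    t.toAddMonoidHom
  have h3 : t.toAddMonoidHom.range = (LinearMap.range t).toAddSubgroup := rfl
  rw [h3, h1] at h2
  rw [← h2, ← AddSubgroup.relIndex_sup_left, AddSubgroup.relIndex_mul_index le_sup_left]

theorem nabla_le {E : Type*} [AddCommGroup E] [Module (Lam ℓ) E] (n : ℕ)
    (Y : Submodule (Lam ℓ) E) : nablaN ℓ n Y ≤ Y :=
  sup_le Submodule.smul_le_right Submodule.smul_le_right

theorem nabla_mono {E : Type*} [AddCommGroup E] [Module (Lam ℓ) E] (n : ℕ)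
    (Y : Submodule (Lam ℓ) E) : nablaN ℓ n Y ≤ nablaN ℓ n ⊤ :=
  sup_le_sup (Submodule.smul_mono le_rfl le_top) (Submodule.smul_mono le_rfl le_top)

end IwAux

/-- If `t : X → E` is a pseudo-isomorphism (finite kernel and cokernel) from a finitely
generated `Λ`-module `X` to an elementary `Λ`-module `E`, the ratios
`(X : ∇_nX)/(E : ∇_nE)` are eventually constant. -/
theorem pseudo_iso_nabla_index_ratio_stationary (ℓ : ℕ) [Fact ℓ.Prime]
    (ρ : ℕ) (ι κ : Type) [Fintype ι] [Fintype κ]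
    (f : ι → Polynomial ℤ_[ℓ]) (hf : ∀ i, IsDistinguishedAt ℓ (f i))
    (m : κ → ℕ) (hm : ∀ j, 0 < m j)
    (E : Type) [AddCommGroup E] [Module (Lam ℓ) E] (e : E ≃ₗ[Lam ℓ] ElemMod ℓ ρ f m)
    (X : Type) [AddCommGroup X] [Module (Lam ℓ) X] [Module.Finite (Lam ℓ) X]
    (t : X →ₗ[Lam ℓ] E)
    (hker : Finite (LinearMap.ker t)) (hcoker : Finite (E ⧸ LinearMap.range t)) :
    ∃ (n₀ a b : ℕ), 0 < a ∧ 0 < b ∧ ∀ n ≥ n₀,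
      b * Nat.card (X ⧸ nablaN ℓ n (⊤ : Submodule (Lam ℓ) X)) =
        a * Nat.card (E ⧸ nablaN ℓ n (⊤ : Submodule (Lam ℓ) E)) := by
  classical
  have hS : IwAux.Shrinks ℓ E := IwAux.shrinks_equiv ℓ e
    (IwAux.shrinks_prod ℓ (IwAux.shrinks_pi ℓ fun _ => IwAux.shrinks_lam ℓ)
      (IwAux.shrinks_prod ℓ (IwAux.shrinks_pi ℓ fun i => IwAux.shrinks_f ℓ (f i) (hf i))
        (IwAux.shrinks_pi ℓ fun j => IwAux.shrinks_pow ℓ (m j))))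
  set Y := LinearMap.range t with hY
  set K := LinearMap.ker t with hK
  have hYi : Y.toAddSubgroup.index ≠ 0 :=
    haveI : Finite (E ⧸ Y.toAddSubgroup) := hcoker
    AddSubgroup.index_ne_zero_of_finite
  -- kernel part
  let c : ℕ → ℕ := fun n =>
    (nablaN ℓ n (⊤ : Submodule (Lam ℓ) X)).toAddSubgroup.relIndex K.toAddSubgroup
  have hKf : Finite K.toAddSubgroup := hker
  have hc0 : ∀ n, c n ≠ 0 := fun n => AddSubgroup.index_ne_zero_of_finite
  have hcB : ∀ n, c n ≤ Nat.card K := fun n =>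
    Nat.card_le_card_of_surjective _ (QuotientAddGroup.mk_surjective)
  have hcm : ∀ n ≥ 0, c n ≤ c (n + 1) := fun n _ =>
    AddSubgroup.relIndex_le_of_le_left (IwAux.nabla_anti ℓ n ⊤) (hc0 _)
  obtain ⟨n1, h1⟩ := IwAux.stabilizes c 0 _ hcm hcB
  -- cokernel part
  let d : ℕ → ℕ := fun n => (Y.prod Y ⊔ LinearMap.ker (IwAux.phi ℓ E n)).toAddSubgroup.index
  have hYY : (Y.prod Y).toAddSubgroup.index ≠ 0 := by
    have : (Y.prod Y).toAddSubgroup = Y.toAddSubgroup.prod Y.toAddSubgroup := rfl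
    rw [this, AddSubgroup.index_prod]
    exact mul_ne_zero hYi hYi
  have hd0 : ∀ n, (Y.prod Y ⊔ LinearMap.ker (IwAux.phi ℓ E n)).toAddSubgroup.FiniteIndex := by
    intro n
    haveI : (Y.prod Y).toAddSubgroup.FiniteIndex := ⟨hYY⟩
    exact AddSubgroup.finiteIndex_of_le
      (show (Y.prod Y).toAddSubgroup ≤ _ from Submodule.toAddSubgroup_mono le_sup_left)
  have hdB : ∀ n, d n ≤ (Y.prod Y).toAddSubgroup.index := by
    intro n
    haveI : (Y.prod Y).toAddSubgroup.FiniteIndex := ⟨hYY⟩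
    exact AddSubgroup.index_antitone (Submodule.toAddSubgroup_mono le_sup_left)
  obtain ⟨k, hk⟩ := IwAux.finite_coker ℓ Y
  obtain ⟨n0, hn0⟩ := hS k
  have hdm : ∀ n ≥ n0, d n ≤ d (n + 1) := by
    intro n hn
    haveI := hd0 (n + 1)
    refine AddSubgroup.index_antitone (Submodule.toAddSubgroup_mono ?_)
    refine sup_le le_sup_left ?_
    rintro ⟨a, b⟩ hab
    have hab' : (ℓ : Lam ℓ) ^ (n + 1 + 1) • a + omegaIw ℓ (n + 1) • b = 0 := by
      simpa [IwAux.phi] using hab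
    obtain ⟨a', b', h, ha, hb⟩ := hn0 n hn a b hab'
    have hk' : ((a', b') : E × E) ∈ LinearMap.ker (IwAux.phi ℓ E n) := by
      simpa [IwAux.phi] using h
    have hy' : ((a - a', b - b') : E × E) ∈ Y.prod Y := ⟨hk ha, hk hb⟩
    have := Submodule.add_mem_sup hy' hk'
    simpa using this
  obtain ⟨n2, h2⟩ := IwAux.stabilizes d n0 _ hdm hdB
  refine ⟨max n1 n2, c n1 * d n2, Y.toAddSubgroup.index,
    Nat.pos_of_ne_zero (mul_ne_zero (hc0 _) (hd0 n2).index_ne_zero), Nat.pos_of_ne_zero hYi, ?_⟩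
  intro n hn
  rw [← h1 n (by omega), ← h2 n (by omega)]
  have e1 := IwAux.index_X ℓ t n
  have e2 : (nablaN ℓ n Y).toAddSubgroup.relIndex Y.toAddSubgroup * Y.toAddSubgroup.index =
      d n * (nablaN ℓ n (⊤ : Submodule (Lam ℓ) E)).toAddSubgroup.index := by
    rw [AddSubgroup.relIndex_mul_index (Submodule.toAddSubgroup_mono (IwAux.nabla_le ℓ n Y)),
      ← AddSubgroup.relIndex_mul_index (Submodule.toAddSubgroup_mono (IwAux.nabla_mono ℓ n Y)),
      IwAux.relIndex_nabla]
  change Y.toAddSubgroup.index * (nablaN ℓ n (⊤ : Submodule (Lam ℓ) X)).toAddSubgroup.index =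
    c n * d n * (nablaN ℓ n (⊤ : Submodule (Lam ℓ) E)).toAddSubgroup.index
  rw [e1, mul_assoc, ← e2]
  simp only [c, hY, hK]
  ring
end

section
/- Theorem of parameters: Let X be a finitely generated Λ-module over Λ = ℤ_ℓ[[T]], with structural invariants ρ (Λ-rank), μ (total ℓ-valuation of the characteristic ideal of the torsion part) and λ (degree of the characteristic polynomial of the torsion part). Then there exist an integer ν and an integer n_0 such that for all n ≥ n_0, the quotient X/∇_nX is finite of order ℓ^{x_n} with x_n = ρ(n+1)ℓ^n + μℓ^n + λn + ν, where ∇_n = ℓ^{n+1}Λ + ω_nΛ and ω_n = (1+T)^{ℓ^n} − 1. -/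
namespace IwPar

open PowerSeries

variable {ℓ : ℕ} [Fact ℓ.Prime]

theorem geom_aux {R : Type*} [CommRing R] (w : R) (N : ℕ) :
    ∃ s, (1 + w) ^ N - 1 = w * (N + w * s) := by
  induction N with
  | zero => exact ⟨0, by simp⟩
  | succ N ih =>
    obtain ⟨s, hs⟩ := ih
    refine ⟨s + N + w * s, ?_⟩
    have : (1 + w) ^ N = 1 + w * (N + w * s) := by rw [← hs]; ring
    rw [pow_succ, this]; push_cast; ring

theorem omega_succ (n : ℕ) :
    ∃ s, omegaIw ℓ (n + 1) = omegaIw ℓ n * ((ℓ : Lam ℓ) + omegaIw ℓ n * s) := by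
  obtain ⟨s, hs⟩ := geom_aux (omegaIw ℓ n) ℓ
  refine ⟨s, ?_⟩
  rw [← hs, omegaIw, omegaIw, pow_succ, pow_mul]
  ring

theorem omega_dvd {n k : ℕ} (h : n ≤ k) : omegaIw ℓ n ∣ omegaIw ℓ k := by
  induction k, h using Nat.le_induction with
  | base => exact dvd_rfl
  | succ k _ ih =>
    obtain ⟨s, hs⟩ := omega_succ (ℓ := ℓ) k
    rw [hs]; exact ih.mul_right _

theorem ell_mem : (ℓ : Lam ℓ) ∈ IsLocalRing.maximalIdeal (Lam ℓ) := by
  rw [IsLocalRing.mem_maximalIdeal, mem_nonunits_iff, PowerSeries.isUnit_iff_constantCoeff]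
  simpa using PadicInt.p_nonunit

theorem X_mem : (X : Lam ℓ) ∈ IsLocalRing.maximalIdeal (Lam ℓ) := by
  rw [IsLocalRing.mem_maximalIdeal, mem_nonunits_iff, PowerSeries.isUnit_iff_constantCoeff]
  simp

theorem omega_mem (n : ℕ) : omegaIw ℓ n ∈ IsLocalRing.maximalIdeal (Lam ℓ) ^ (n + 1) := by
  induction n with
  | zero => simpa [omegaIw] using X_mem
  | succ n ih =>
    obtain ⟨s, hs⟩ := omega_succ (ℓ := ℓ) n
    rw [hs, pow_succ]
    refine Ideal.mul_mem_mul ih (Ideal.add_mem _ ell_mem (Ideal.mul_mem_right _ _ ?_))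
    exact Ideal.pow_le_self (by omega) ih

theorem omega_eq (n : ℕ) : ∃ r, omegaIw ℓ n = X ^ ℓ ^ n + (ℓ : Lam ℓ) * r := by
  obtain ⟨r, hr⟩ := exists_add_pow_prime_pow_eq (Fact.out : ℓ.Prime) (1 : Lam ℓ) X n
  refine ⟨1 * X * r, ?_⟩
  rw [omegaIw, hr]; ring

theorem dist_eq {f : Polynomial ℤ_[ℓ]} (hf : IsDistinguishedAt ℓ f) :
    ∃ g : Lam ℓ, (f : Lam ℓ) = X ^ f.natDegree + (ℓ : Lam ℓ) * g := by
  have h : ∀ i, ∃ c : ℤ_[ℓ], f.coeff i = (if i = f.natDegree then 1 else 0) + ℓ * c := by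
    intro i
    rcases lt_trichotomy i f.natDegree with h | h | h
    · obtain ⟨c, hc⟩ := Ideal.mem_span_singleton'.1 (hf.2 i h)
      exact ⟨c, by simp [h.ne, ← hc, mul_comm]⟩
    · exact ⟨0, by simp [h, hf.1]⟩
    · exact ⟨0, by simp [h.ne', Polynomial.coeff_eq_zero_of_natDegree_lt h]⟩
  choose c hc using h
  refine ⟨PowerSeries.mk c, ?_⟩
  ext i
  have : (ℓ : Lam ℓ) = PowerSeries.C (ℓ : ℤ_[ℓ]) := by simp
  rw [this]
  rw [Polynomial.coeff_coe, map_add, PowerSeries.coeff_C_mul, PowerSeries.coeff_X_pow, hc,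
    PowerSeries.coeff_mk]

/-- `ω_n` is divisible by high powers of `ℓ` modulo `f`. -/
theorem omega_mod {f : Polynomial ℤ_[ℓ]} (hf : IsDistinguishedAt ℓ f) :
    ∃ n₀, ∀ k, ∃ a b, omegaIw ℓ (n₀ + k) = (ℓ : Lam ℓ) ^ (k + 1) * a + (f : Lam ℓ) * b := by
  refine ⟨f.natDegree, fun k => ?_⟩
  induction k with
  | zero =>
    obtain ⟨r, hr⟩ := omega_eq (ℓ := ℓ) f.natDegree
    obtain ⟨g, hg⟩ := dist_eq hf
    have hle : f.natDegree ≤ ℓ ^ f.natDegree :=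
      (Nat.lt_pow_self (Fact.out : ℓ.Prime).one_lt).le
    obtain ⟨e, he⟩ := Nat.exists_eq_add_of_le hle
    refine ⟨r - g * X ^ e, X ^ e, ?_⟩
    rw [add_zero, hr, hg]
    conv_lhs => rw [he, pow_add]
    ring
  | succ k ih =>
    obtain ⟨a, b, hab⟩ := ih
    obtain ⟨s, hs⟩ := omega_succ (ℓ := ℓ) (f.natDegree + k)
    refine ⟨a * (1 + (ℓ : Lam ℓ) ^ k * a * s), ?_⟩
    refine ⟨omegaIw ℓ (f.natDegree + k) * b * s + b * (ℓ + (ℓ : Lam ℓ) ^ (k+1) * a * s), ?_⟩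
    rw [← add_assoc, hs, hab]; ring

noncomputable def omegaPoly (ℓ : ℕ) [Fact ℓ.Prime] (n : ℕ) : Polynomial ℤ_[ℓ] :=
  (1 + Polynomial.X) ^ (ℓ ^ n) - 1

theorem omegaPoly_coe (n : ℕ) : ((omegaPoly ℓ n : Polynomial ℤ_[ℓ]) : Lam ℓ) = omegaIw ℓ n := by
  simp [omegaPoly, omegaIw]

theorem omegaPoly_natDegree (n : ℕ) : (omegaPoly ℓ n).natDegree = ℓ ^ n := by
  have h : (1 + Polynomial.X : Polynomial ℤ_[ℓ]) = Polynomial.X + Polynomial.C 1 := by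
    rw [add_comm]; simp
  have h1 : (Polynomial.C 1 : Polynomial ℤ_[ℓ]) = 1 := by simp
  rw [omegaPoly, h, ← h1, Polynomial.natDegree_sub_C, Polynomial.natDegree_pow,
    Polynomial.natDegree_X_add_C, mul_one]

theorem omegaPoly_dist (n : ℕ) : IsDistinguishedAt ℓ (omegaPoly ℓ n) := by
  have h : (1 + Polynomial.X : Polynomial ℤ_[ℓ]) = Polynomial.X + Polynomial.C 1 := by
    rw [add_comm]; simp
  have hpos : 0 < ℓ ^ n := pow_pos (Fact.out : ℓ.Prime).pos _
  constructor
  · have hm : ((1 + Polynomial.X : Polynomial ℤ_[ℓ]) ^ (ℓ ^ n)).Monic := by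
      rw [h]; exact (Polynomial.monic_X_add_C 1).pow _
    refine hm.sub_of_left ?_
    rw [Polynomial.degree_one, h, Polynomial.degree_pow, Polynomial.degree_X_add_C]
    simpa using (by exact_mod_cast hpos : (0 : WithBot ℕ) < (ℓ : WithBot ℕ) ^ n)
  · intro i hi
    rw [omegaPoly_natDegree] at hi
    obtain ⟨r, hr⟩ := omega_eq (ℓ := ℓ) n
    have : (ℓ : Lam ℓ) = PowerSeries.C (ℓ : ℤ_[ℓ]) := by simp
    rw [← omegaPoly_coe, this] at hr
    have := congrArg (PowerSeries.coeff i) hr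
    rw [Polynomial.coeff_coe] at this
    rw [this, Ideal.mem_span_singleton]
    rw [map_add, PowerSeries.coeff_C_mul, PowerSeries.coeff_X_pow, if_neg hi.ne, zero_add]
    exact dvd_mul_right _ _

theorem quot_equiv {g : Polynomial ℤ_[ℓ]} (hg : IsDistinguishedAt ℓ g) :
    Nonempty ((Lam ℓ ⧸ Ideal.span {(g : Lam ℓ)}) ≃ₗ[ℤ_[ℓ]] (Fin g.natDegree → ℤ_[ℓ])) := by
  have hd : g.IsDistinguishedAt (IsLocalRing.maximalIdeal ℤ_[ℓ]) := by
    refine ⟨⟨fun {i} hi => ?_⟩, hg.1⟩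
    rw [PadicInt.maximalIdeal_eq_span_p]
    exact hg.2 i hi
  have e1 := hd.algEquivQuotient.symm.toLinearEquiv
  have e2 := (AdjoinRoot.powerBasis' hg.1).basis.equivFun
  exact ⟨e1.trans e2⟩

theorem card_zp (k : ℕ) :
    (Ideal.span {(ℓ : ℤ_[ℓ]) ^ k}).toAddSubgroup.index = ℓ ^ k := by
  rw [← PadicInt.ker_toZModPow]
  have h := AddSubgroup.index_ker (PadicInt.toZModPow (p := ℓ) k).toAddMonoidHom
  have hs : (PadicInt.toZModPow (p := ℓ) k).toAddMonoidHom.range = ⊤ := by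
    rw [AddMonoidHom.range_eq_top]
    exact ZMod.ringHom_surjective (PadicInt.toZModPow (p := ℓ) k)
  rw [hs] at h
  simp at h
  exact h

/-- The subgroup `ℓ^k G`. -/
def pm (ℓ : ℕ) (G : Type*) [AddCommGroup G] (k : ℕ) : AddSubgroup G :=
  (nsmulAddMonoidHom (α := G) (ℓ ^ k)).range

theorem mem_pm {G : Type*} [AddCommGroup G] {k : ℕ} {x : G} :
    x ∈ pm ℓ G k ↔ ∃ y, (ℓ ^ k) • y = x := by
  simp [pm]

theorem pm_index_equiv {G H : Type*} [AddCommGroup G] [AddCommGroup H] (e : G ≃+ H) (k : ℕ) :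
    (pm ℓ G k).index = (pm ℓ H k).index := by
  have : pm ℓ G k = (pm ℓ H k).comap e.toAddMonoidHom := by
    ext x
    rw [AddSubgroup.mem_comap, mem_pm, mem_pm]
    constructor
    · rintro ⟨y, rfl⟩; exact ⟨e y, by simp⟩
    · rintro ⟨y, hy⟩
      refine ⟨e.symm y, e.injective ?_⟩
      simpa using hy
  rw [this, AddSubgroup.index_comap_of_surjective _ e.surjective]

theorem pm_index_pi (d k : ℕ) : (pm ℓ (Fin d → ℤ_[ℓ]) k).index = ℓ ^ (k * d) := by
  have : pm ℓ (Fin d → ℤ_[ℓ]) k =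
      AddSubgroup.pi Set.univ (fun _ => (Ideal.span {(ℓ : ℤ_[ℓ]) ^ k}).toAddSubgroup) := by
    ext x
    rw [mem_pm, AddSubgroup.mem_pi]
    constructor
    · rintro ⟨y, rfl⟩ i -
      exact Ideal.mem_span_singleton'.2 ⟨y i, by simp [mul_comm]⟩
    · intro h
      choose y hy using fun i => Ideal.mem_span_singleton'.1 (h i trivial)
      exact ⟨y, by ext i; simp [← hy, mul_comm]⟩
  rw [this, AddSubgroup.index_pi]
  simp [card_zp, pow_mul]

theorem pm_index_quot {g : Polynomial ℤ_[ℓ]} (hg : IsDistinguishedAt ℓ g) (k : ℕ) :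
    (pm ℓ (Lam ℓ ⧸ Ideal.span {(g : Lam ℓ)}) k).index = ℓ ^ (k * g.natDegree) := by
  obtain ⟨e⟩ := quot_equiv hg
  rw [pm_index_equiv e.toAddEquiv, pm_index_pi]

theorem quot_tf {g : Polynomial ℤ_[ℓ]} (hg : IsDistinguishedAt ℓ g) (k : ℕ)
    (x : Lam ℓ ⧸ Ideal.span {(g : Lam ℓ)}) (hx : ℓ ^ k • x = 0) : x = 0 := by
  obtain ⟨e⟩ := quot_equiv hg
  apply e.injective
  have h := congrArg e hx
  rw [map_nsmul, map_zero] at h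
  rw [map_zero]
  have h0 : (ℓ ^ k : ℕ) ≠ 0 := pow_ne_zero _ (Fact.out : ℓ.Prime).ne_zero
  exact (smul_eq_zero.1 h).resolve_left h0

theorem omega_ne_zero (n : ℕ) : omegaIw ℓ n ≠ 0 := by
  rw [← omegaPoly_coe]
  intro h
  have : omegaPoly ℓ n = 0 := by exact_mod_cast h
  exact (omegaPoly_dist (ℓ := ℓ) n).1.ne_zero this

theorem omega_nzd {n k : ℕ} {b a : Lam ℓ} (h : omegaIw ℓ n * b = (ℓ : Lam ℓ) ^ k * a) :
    ∃ c, b = (ℓ : Lam ℓ) ^ k * c ∧ a = omegaIw ℓ n * c := by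
  have h1 := quot_tf (omegaPoly_dist (ℓ := ℓ) n) k (Ideal.Quotient.mk _ a) (by
    rw [← map_nsmul, Ideal.Quotient.eq_zero_iff_mem, omegaPoly_coe, Ideal.mem_span_singleton]
    exact ⟨b, by rw [h]; simp⟩)
  rw [Ideal.Quotient.eq_zero_iff_mem, omegaPoly_coe, Ideal.mem_span_singleton] at h1
  obtain ⟨c, rfl⟩ := h1
  refine ⟨c, mul_left_cancel₀ (omega_ne_zero n) ?_, rfl⟩
  rw [h]; ring

section nab

variable (ℓ) in
/-- `∇_n M` as an additive subgroup. -/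
noncomputable def nab (n : ℕ) (M : Type*) [AddCommGroup M] [Module (Lam ℓ) M] : AddSubgroup M :=
  (nablaN ℓ n (⊤ : Submodule (Lam ℓ) M)).toAddSubgroup

variable {M : Type*} [AddCommGroup M] [Module (Lam ℓ) M]

theorem mem_nablaN {n : ℕ} {x : M} : x ∈ nablaN ℓ n (⊤ : Submodule (Lam ℓ) M) ↔
    ∃ a b : M, (ℓ : Lam ℓ) ^ (n + 1) • a + omegaIw ℓ n • b = x := by
  rw [nablaN, Submodule.mem_sup]
  simp only [Submodule.ideal_span_singleton_smul,
    Submodule.mem_smul_pointwise_iff_exists]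
  constructor
  · rintro ⟨_, ⟨a, -, rfl⟩, _, ⟨b, -, rfl⟩, rfl⟩; exact ⟨a, b, rfl⟩
  · rintro ⟨a, b, rfl⟩; exact ⟨_, ⟨a, trivial, rfl⟩, _, ⟨b, trivial, rfl⟩, rfl⟩

theorem mem_nab {n : ℕ} {x : M} : x ∈ nab ℓ n M ↔
    ∃ a b : M, (ℓ : Lam ℓ) ^ (n + 1) • a + omegaIw ℓ n • b = x := mem_nablaN

theorem nab_anti {n k : ℕ} (h : n ≤ k) : nab ℓ k M ≤ nab ℓ n M := by
  intro x hx
  rw [mem_nab] at hx ⊢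
  obtain ⟨a, b, rfl⟩ := hx
  obtain ⟨c, hc⟩ := omega_dvd (ℓ := ℓ) h
  obtain ⟨e, rfl⟩ := Nat.exists_eq_add_of_le h
  refine ⟨(ℓ : Lam ℓ) ^ e • a, c • b, ?_⟩
  rw [smul_smul, smul_smul, ← hc, ← pow_add]
  congr 3; ring

theorem card_eq (n : ℕ) :
    Nat.card (M ⧸ nablaN ℓ n (⊤ : Submodule (Lam ℓ) M)) = (nab ℓ n M).index := rfl

end nab

theorem index_lam_aux (n k : ℕ) (H : AddSubgroup (Lam ℓ))
    (hH : ∀ x, x ∈ H ↔ ∃ a b, (ℓ : Lam ℓ) ^ k * a + omegaIw ℓ n * b = x) :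
    H.index = ℓ ^ (k * ℓ ^ n) := by
  have h := pm_index_quot (omegaPoly_dist (ℓ := ℓ) n) k
  rw [omegaPoly_natDegree] at h
  rw [← h, ← AddSubgroup.index_comap_of_surjective _
    (f := (Ideal.Quotient.mk (Ideal.span {(omegaPoly ℓ n : Lam ℓ)})).toAddMonoidHom)
    Ideal.Quotient.mk_surjective]
  congr 1
  ext x
  rw [hH, AddSubgroup.mem_comap, mem_pm]
  constructor
  · rintro ⟨a, b, rfl⟩
    refine ⟨Ideal.Quotient.mk _ a, ?_⟩
    rw [← map_nsmul]
    refine Ideal.Quotient.eq.2 ?_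
    rw [omegaPoly_coe, Ideal.mem_span_singleton]
    exact ⟨-b, by simp⟩
  · rintro ⟨y, hy⟩
    obtain ⟨y, rfl⟩ := Ideal.Quotient.mk_surjective y
    rw [← map_nsmul] at hy
    have hy := Ideal.Quotient.eq.1 hy
    rw [omegaPoly_coe, Ideal.mem_span_singleton] at hy
    obtain ⟨b, hb⟩ := hy
    refine ⟨y, -b, ?_⟩
    rw [mul_neg, ← hb]; simp

theorem index_lam (n : ℕ) : (nab ℓ n (Lam ℓ)).index = ℓ ^ ((n + 1) * ℓ ^ n) :=
  index_lam_aux n (n + 1) _ fun _ => mem_nab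

theorem index_mu (m n : ℕ) (h : m ≤ n + 1) :
    (nab ℓ n (Lam ℓ ⧸ Ideal.span {(ℓ : Lam ℓ) ^ m})).index = ℓ ^ (m * ℓ ^ n) := by
  rw [← AddSubgroup.index_comap_of_surjective _
    (f := (Ideal.Quotient.mk (Ideal.span {(ℓ : Lam ℓ) ^ m})).toAddMonoidHom)
    Ideal.Quotient.mk_surjective]
  refine index_lam_aux n m _ fun x => ?_
  rw [AddSubgroup.mem_comap, mem_nab]
  obtain ⟨e, he⟩ := Nat.exists_eq_add_of_le h
  constructor
  · rintro ⟨a, b, hy⟩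
    obtain ⟨a, rfl⟩ := Ideal.Quotient.mk_surjective a
    obtain ⟨b, rfl⟩ := Ideal.Quotient.mk_surjective b
    have hy := Ideal.mem_span_singleton.1 (Ideal.Quotient.eq.1 hy)
    obtain ⟨c, hc⟩ := hy
    refine ⟨(ℓ : Lam ℓ) ^ e * a - c, b, ?_⟩
    rw [mul_sub, ← hc, he, pow_add]
    simp only [smul_eq_mul]
    ring
  · rintro ⟨a, b, rfl⟩
    refine ⟨0, Ideal.Quotient.mk _ b, ?_⟩
    rw [smul_zero, zero_add]
    refine Ideal.Quotient.eq.2 (Ideal.mem_span_singleton.2 ⟨-a, ?_⟩)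
    simp only [smul_eq_mul]
    ring

/-- On `Λ/f`, `ω_{n+1} = ℓ(1+ℓ^k z) ω_n` for large `n`. -/
theorem omega_quot {f : Polynomial ℤ_[ℓ]} (hf : IsDistinguishedAt ℓ f) (k : ℕ) :
    ∃ n₀, ∀ n ≥ n₀, ∃ z : Lam ℓ, ∀ x : Lam ℓ ⧸ Ideal.span {(f : Lam ℓ)},
      omegaIw ℓ (n + 1) • x = (ℓ : Lam ℓ) • omegaIw ℓ n • (1 + (ℓ : Lam ℓ) ^ k * z) • x := by
  obtain ⟨n₀, h0⟩ := omega_mod hf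
  refine ⟨n₀ + k, fun n hn => ?_⟩
  obtain ⟨e, rfl⟩ := Nat.exists_eq_add_of_le hn
  obtain ⟨a, b, hab⟩ := h0 (k + e)
  obtain ⟨s, hs⟩ := omega_succ (ℓ := ℓ) (n₀ + k + e)
  refine ⟨(ℓ : Lam ℓ) ^ e * a * s, fun x => ?_⟩
  obtain ⟨x, rfl⟩ := Ideal.Quotient.mk_surjective x
  refine Ideal.Quotient.eq.2 (Ideal.mem_span_singleton.2
    ⟨omegaIw ℓ (n₀ + k + e) * b * s * x, ?_⟩)
  simp only [smul_eq_mul]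
  rw [hs]
  rw [← add_assoc] at hab
  have : omegaIw ℓ (n₀ + k + e) * ((ℓ : Lam ℓ) + omegaIw ℓ (n₀ + k + e) * s) =
    omegaIw ℓ (n₀ + k + e) * (ℓ + ((ℓ : Lam ℓ) ^ (k + e + 1) * a + f * b) * s) := by
    rw [← hab]
  rw [this]; ring

theorem isUnit_one_add (k : ℕ) (hk : k ≠ 0) (z : Lam ℓ) : IsUnit (1 + (ℓ : Lam ℓ) ^ k * z) := by
  have h : (ℓ : Lam ℓ) ^ k * z ∈ IsLocalRing.maximalIdeal (Lam ℓ) :=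
    Ideal.mul_mem_right _ _ (Ideal.pow_mem_of_mem _ ell_mem _ (Nat.pos_of_ne_zero hk))
  by_contra hu
  have h2 := Ideal.sub_mem _ ((IsLocalRing.mem_maximalIdeal _).2 hu) h
  rw [add_sub_cancel_right] at h2
  exact (IsLocalRing.mem_maximalIdeal _).1 h2 isUnit_one

/-- A finite `Λ`-module has `ℓ`-power order. -/
theorem card_pow (M : Type*) [AddCommGroup M] [Module (Lam ℓ) M] [Finite M] :
    ∃ k, Nat.card M = ℓ ^ k := by
  refine ⟨_, Nat.eq_prime_pow_of_unique_prime_dvd Nat.card_pos.ne' fun {p} hp hdvd => ?_⟩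
  by_contra hne
  have : Fact p.Prime := ⟨hp⟩
  obtain ⟨x, hx⟩ := exists_prime_addOrderOf_dvd_card' p hdvd
  have h1 : (p : Lam ℓ) • x = 0 := by
    rw [Nat.cast_smul_eq_nsmul, ← hx]; exact addOrderOf_nsmul_eq_zero x
  have hu : IsUnit (p : Lam ℓ) := by
    rw [PowerSeries.isUnit_iff_constantCoeff]
    rw [map_natCast, PadicInt.isUnit_iff]
    have := (PadicInt.norm_natCast_eq_one_iff (p := ℓ) (n := p)).2
      ((Nat.coprime_primes Fact.out hp).2 (Ne.symm hne))
    exact this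
  have h2 : x = 0 := (hu.smul_eq_zero).1 h1
  rw [h2, addOrderOf_zero] at hx
  exact hp.one_lt.ne hx

open Filter

theorem index_lambda {f : Polynomial ℤ_[ℓ]} (hf : IsDistinguishedAt ℓ f) :
    ∃ u v : ℕ, ∀ᶠ n in atTop, (nab ℓ n (Lam ℓ ⧸ Ideal.span {(f : Lam ℓ)})).index * ℓ ^ u =
      ℓ ^ (f.natDegree * n + v) := by
  obtain ⟨n₀, h0⟩ := omega_quot hf 1
  have hdvd : (nab ℓ n₀ (Lam ℓ ⧸ Ideal.span {(f : Lam ℓ)})).index ∣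
      ℓ ^ ((n₀ + 1) * f.natDegree) := by
    rw [← pm_index_quot hf]
    refine AddSubgroup.index_dvd_of_le fun x hx => ?_
    obtain ⟨y, rfl⟩ := mem_pm.1 hx
    refine mem_nab.2 ⟨y, 0, ?_⟩
    rw [smul_zero, add_zero, ← Nat.cast_pow, Nat.cast_smul_eq_nsmul]
  obtain ⟨c, -, hc⟩ := (Nat.dvd_prime_pow (Fact.out : ℓ.Prime)).1 hdvd
  have key : ∀ e, (nab ℓ (n₀ + e) (Lam ℓ ⧸ Ideal.span {(f : Lam ℓ)})).index =
      ℓ ^ (f.natDegree * e + c) := by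
    intro e
    induction e with
    | zero => simpa using hc
    | succ e ih =>
      obtain ⟨z, hz⟩ := h0 (n₀ + e) (by omega)
      obtain ⟨u, hu⟩ := isUnit_one_add (ℓ := ℓ) 1 one_ne_zero z
      simp only [pow_one] at hz hu
      have hmap : nab ℓ (n₀ + (e + 1)) (Lam ℓ ⧸ Ideal.span {(f : Lam ℓ)}) =
          (nab ℓ (n₀ + e) (Lam ℓ ⧸ Ideal.span {(f : Lam ℓ)})).map
            (nsmulAddMonoidHom (ℓ ^ 1)) := by
        ext x
        rw [← add_assoc, mem_nab, AddSubgroup.mem_map]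
        constructor
        · rintro ⟨a, b, rfl⟩
          refine ⟨_, mem_nab.2 ⟨a, (1 + (ℓ : Lam ℓ) * z) • b, rfl⟩, ?_⟩
          rw [hz, nsmulAddMonoidHom_apply, pow_one, ← Nat.cast_smul_eq_nsmul (Lam ℓ), smul_add]
          congr 1
          rw [smul_smul, pow_succ' _ (n₀ + e + 1)]
        · rintro ⟨y, hy, rfl⟩
          obtain ⟨a, b, rfl⟩ := mem_nab.1 hy
          refine ⟨a, (↑u⁻¹ : Lam ℓ) • b, ?_⟩
          rw [hz, nsmulAddMonoidHom_apply, pow_one, ← Nat.cast_smul_eq_nsmul (Lam ℓ), smul_add]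
          congr 1
          · rw [smul_smul, pow_succ' _ (n₀ + e + 1)]
          · rw [← hu, smul_smul (u : Lam ℓ), Units.mul_inv, one_smul]
      rw [hmap, AddSubgroup.index_map_of_injective, ih]
      · have := pm_index_quot hf 1
        rw [pm] at this
        rw [this, ← pow_add]
        congr 1; ring
      · rw [injective_iff_map_eq_zero]
        intro x hx
        exact quot_tf hf 1 x hx
  refine ⟨f.natDegree * n₀, c, eventually_atTop.2 ⟨n₀, fun n hn => ?_⟩⟩
  obtain ⟨e, rfl⟩ := Nat.exists_eq_add_of_le hn
  rw [key, ← pow_add]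
  congr 1; ring

variable (ℓ) in
/-- Stability of the relations between `ℓ^{n+1}` and `ω_n` on `M`. -/
def Stab (M : Type*) [AddCommGroup M] [Module (Lam ℓ) M] : Prop :=
  ∀ N : ℕ, ∀ᶠ n in atTop, ∀ a b : M, (ℓ : Lam ℓ) ^ (n + 1) • a + omegaIw ℓ n • b = 0 →
    ∃ a' b' : M, (ℓ : Lam ℓ) ^ (n + 1 + 1) • a' + omegaIw ℓ (n + 1) • b' = 0 ∧
      a' - a ∈ nab ℓ N M ∧ b' - b ∈ nab ℓ N M

theorem stab_lam : Stab ℓ (Lam ℓ) := by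
  intro N
  filter_upwards [eventually_ge_atTop N] with n hn a b h
  refine ⟨0, 0, by simp, nab_anti hn ?_, nab_anti hn ?_⟩
  all_goals
    simp only [smul_eq_mul] at h
    obtain ⟨c, h1, h2⟩ := omega_nzd (ℓ := ℓ) (n := n) (k := n + 1) (b := b) (a := -a)
      (by linear_combination h)
    rw [mem_nab]
  · exact ⟨0, c, by simp [h2]⟩
  · exact ⟨-c, 0, by simp [h1]⟩

theorem stab_mu (m : ℕ) : Stab ℓ (Lam ℓ ⧸ Ideal.span {(ℓ : Lam ℓ) ^ m}) := by
  intro N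
  have hz : ∀ n, m ≤ n → ∀ a : Lam ℓ ⧸ Ideal.span {(ℓ : Lam ℓ) ^ m},
      (ℓ : Lam ℓ) ^ n • a = 0 := by
    intro n hn a
    obtain ⟨a, rfl⟩ := Ideal.Quotient.mk_surjective a
    refine Ideal.Quotient.eq_zero_iff_mem.2 (Ideal.mem_span_singleton.2 ?_)
    exact (pow_dvd_pow _ hn).mul_right _
  filter_upwards [eventually_ge_atTop m] with n hn a b h
  rw [hz _ (by omega), zero_add] at h
  have hb : b = 0 := by
    obtain ⟨b, rfl⟩ := Ideal.Quotient.mk_surjective b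
    obtain ⟨a, ha⟩ := Ideal.mem_span_singleton.1 (Ideal.Quotient.eq_zero_iff_mem.1 h)
    obtain ⟨c, h1, -⟩ := omega_nzd (ℓ := ℓ) ha
    exact Ideal.Quotient.eq_zero_iff_mem.2 (Ideal.mem_span_singleton.2 ⟨c, h1⟩)
  refine ⟨a, b, ?_, by simp [zero_mem], by simp [zero_mem]⟩
  rw [hz _ (by omega), hb]; simp

theorem stab_lambda {f : Polynomial ℤ_[ℓ]} (hf : IsDistinguishedAt ℓ f) :
    Stab ℓ (Lam ℓ ⧸ Ideal.span {(f : Lam ℓ)}) := by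
  intro N
  obtain ⟨n₀, h0⟩ := omega_quot hf (N + 1)
  filter_upwards [eventually_ge_atTop n₀] with n hn a b h
  obtain ⟨z, hz⟩ := h0 n hn
  refine ⟨(1 + (ℓ : Lam ℓ) ^ (N + 1) * z) • a, b, ?_, ?_, by simp [zero_mem]⟩
  · rw [hz]
    have := congrArg (fun y => ((ℓ : Lam ℓ) * (1 + (ℓ : Lam ℓ) ^ (N + 1) * z)) • y) h
    simp only [smul_zero, smul_add, smul_smul] at this ⊢
    rw [← this]
    congr 2 <;> ring
  · rw [mem_nab]
    refine ⟨z • a, 0, ?_⟩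
    rw [add_smul, one_smul, add_sub_cancel_left, smul_smul, smul_zero, add_zero]

section prods

variable {M N : Type*} [AddCommGroup M] [Module (Lam ℓ) M] [AddCommGroup N] [Module (Lam ℓ) N]

theorem mem_nab_prod {n : ℕ} {x : M × N} :
    x ∈ nab ℓ n (M × N) ↔ x.1 ∈ nab ℓ n M ∧ x.2 ∈ nab ℓ n N := by
  simp only [mem_nab]
  constructor
  · rintro ⟨a, b, rfl⟩
    exact ⟨⟨a.1, b.1, rfl⟩, ⟨a.2, b.2, rfl⟩⟩
  · rintro ⟨⟨a, b, h⟩, ⟨c, d, h'⟩⟩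
    exact ⟨(a, c), (b, d), Prod.ext h h'⟩

theorem index_nab_prod (n : ℕ) :
    (nab ℓ n (M × N)).index = (nab ℓ n M).index * (nab ℓ n N).index := by
  rw [← AddSubgroup.index_prod]
  congr 1
  ext x
  rw [mem_nab_prod, AddSubgroup.mem_prod]

theorem stab_prod (hM : Stab ℓ M) (hN : Stab ℓ N) : Stab ℓ (M × N) := by
  intro K
  filter_upwards [hM K, hN K] with n h1 h2 a b h
  obtain ⟨a1, b1, e1, p1, q1⟩ := h1 a.1 b.1 (congrArg Prod.fst h)
  obtain ⟨a2, b2, e2, p2, q2⟩ := h2 a.2 b.2 (congrArg Prod.snd h)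
  exact ⟨(a1, a2), (b1, b2), Prod.ext e1 e2, mem_nab_prod.2 ⟨p1, p2⟩, mem_nab_prod.2 ⟨q1, q2⟩⟩

variable {ι : Type*} [Fintype ι] {P : ι → Type*} [∀ i, AddCommGroup (P i)]
  [∀ i, Module (Lam ℓ) (P i)]

theorem mem_nab_pi {n : ℕ} {x : (i : ι) → P i} :
    x ∈ nab ℓ n ((i : ι) → P i) ↔ ∀ i, x i ∈ nab ℓ n (P i) := by
  simp only [mem_nab]
  constructor
  · rintro ⟨a, b, rfl⟩ i
    exact ⟨a i, b i, rfl⟩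
  · intro h
    choose a b h using h
    exact ⟨a, b, funext h⟩

theorem index_nab_pi (n : ℕ) :
    (nab ℓ n ((i : ι) → P i)).index = ∏ i, (nab ℓ n (P i)).index := by
  classical
  have h : nablaN ℓ n (⊤ : Submodule (Lam ℓ) ((i : ι) → P i)) =
      Submodule.pi Set.univ fun i => nablaN ℓ n (⊤ : Submodule (Lam ℓ) (P i)) := by
    ext x
    rw [Submodule.mem_pi]
    exact mem_nab_pi.trans ⟨fun h i _ => h i, fun h i => h i trivial⟩
  simp only [← card_eq]
  rw [h, Nat.card_congr (Submodule.quotientPi _).toEquiv, Nat.card_pi]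

theorem stab_pi (h : ∀ i, Stab ℓ (P i)) : Stab ℓ ((i : ι) → P i) := by
  intro K
  filter_upwards [eventually_all.2 fun i => h i K] with n h1 a b hab
  choose a' b' e p q using fun i => h1 i (a i) (b i) (congrFun hab i)
  exact ⟨a', b', funext e, mem_nab_pi.2 p, mem_nab_pi.2 q⟩

end prods

theorem stab_elem (ρ : ℕ) {ι κ : Type} [Fintype ι] [Fintype κ]
    (f : ι → Polynomial ℤ_[ℓ]) (hf : ∀ i, IsDistinguishedAt ℓ (f i)) (m : κ → ℕ) :
    Stab ℓ (ElemMod ℓ ρ f m) :=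
  stab_prod (stab_pi fun _ => stab_lam)
    (stab_prod (stab_pi fun i => stab_lambda (hf i)) (stab_pi fun j => stab_mu (m j)))

theorem index_elem (ρ : ℕ) {ι κ : Type} [Fintype ι] [Fintype κ]
    (f : ι → Polynomial ℤ_[ℓ]) (hf : ∀ i, IsDistinguishedAt ℓ (f i)) (m : κ → ℕ) :
    ∃ u v : ℕ, ∀ᶠ n in atTop, (nab ℓ n (ElemMod ℓ ρ f m)).index * ℓ ^ u =
      ℓ ^ (ρ * (n + 1) * ℓ ^ n + (∑ j, m j) * ℓ ^ n + (∑ i, (f i).natDegree) * n + v) := by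
  choose u v h using fun i => index_lambda (hf i)
  refine ⟨∑ i, u i, ∑ i, v i, ?_⟩
  filter_upwards [eventually_all.2 h, eventually_all.2 fun j => eventually_ge_atTop (m j)]
    with n h1 h2
  have e1 : (∏ i, (nab ℓ n (Lam ℓ ⧸ Ideal.span {((f i : Lam ℓ))})).index) * ℓ ^ (∑ i, u i) =
      ℓ ^ ((∑ i, (f i).natDegree) * n + ∑ i, v i) := by
    rw [← Finset.prod_pow_eq_pow_sum, ← Finset.prod_mul_distrib, Finset.sum_mul,
      ← Finset.sum_add_distrib, ← Finset.prod_pow_eq_pow_sum]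
    exact Finset.prod_congr rfl fun i _ => h1 i
  have e2 : (∏ j, (nab ℓ n (Lam ℓ ⧸ Ideal.span {(ℓ : Lam ℓ) ^ m j})).index) =
      ℓ ^ ((∑ j, m j) * ℓ ^ n) := by
    rw [Finset.sum_mul, ← Finset.prod_pow_eq_pow_sum]
    exact Finset.prod_congr rfl fun j _ => index_mu _ _ ((h2 j).trans (Nat.le_succ n))
  rw [index_nab_prod, index_nab_prod, index_nab_pi, index_nab_pi, index_nab_pi, e2]
  simp only [index_lam, Finset.prod_const, Finset.card_univ, Fintype.card_fin]
  rw [mul_assoc, mul_right_comm (∏ i, _), e1, ← pow_mul, ← pow_add, ← pow_add]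
  congr 1; ring

theorem krull (M : Type*) [AddCommGroup M] [Module (Lam ℓ) M] [Module.Finite (Lam ℓ) M]
    (S : Set M) (hS : S.Finite) : ∀ᶠ n in atTop, ∀ x ∈ S, x ∈ nab ℓ n M → x = 0 := by
  rw [eventually_all_finite hS]
  intro x _
  by_cases hx : x = 0
  · exact Eventually.of_forall fun _ _ => hx
  have hbot := Ideal.iInf_pow_smul_eq_bot_of_isLocalRing (M := M)
    (IsLocalRing.maximalIdeal (Lam ℓ)) (Ideal.IsPrime.ne_top inferInstance)
  have hx' : x ∉ (⨅ i : ℕ, IsLocalRing.maximalIdeal (Lam ℓ) ^ i • (⊤ : Submodule (Lam ℓ) M)) := by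
    rw [hbot]; simpa using hx
  rw [Submodule.mem_iInf, not_forall] at hx'
  obtain ⟨k, hk⟩ := hx'
  filter_upwards [eventually_ge_atTop k] with n hn h
  exfalso
  apply hk
  obtain ⟨a, b, rfl⟩ := mem_nab.1 h
  have hle : IsLocalRing.maximalIdeal (Lam ℓ) ^ (n + 1) ≤ IsLocalRing.maximalIdeal (Lam ℓ) ^ k :=
    Ideal.pow_le_pow_right (by omega)
  exact Submodule.add_mem _
    (Submodule.smul_mem_smul (hle (Ideal.pow_mem_pow ell_mem _)) trivial)
    (Submodule.smul_mem_smul (hle (omega_mem n)) trivial)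

variable (ℓ) in
/-- The map `(a, b) ↦ ℓ^{n+1} a + ω_n b`. -/
noncomputable def phi (n : ℕ) (M : Type*) [AddCommGroup M] [Module (Lam ℓ) M] :
    M × M →ₗ[Lam ℓ] M :=
  (ℓ : Lam ℓ) ^ (n + 1) • LinearMap.fst (Lam ℓ) M M + omegaIw ℓ n • LinearMap.snd (Lam ℓ) M M

theorem phi_apply (n : ℕ) (M : Type*) [AddCommGroup M] [Module (Lam ℓ) M] (x : M × M) :
    phi ℓ n M x = (ℓ : Lam ℓ) ^ (n + 1) • x.1 + omegaIw ℓ n • x.2 := by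
  simp [phi]

theorem assembly (X E : Type*) [AddCommGroup X] [Module (Lam ℓ) X] [Module.Finite (Lam ℓ) X]
    [AddCommGroup E] [Module (Lam ℓ) E] [Module.Finite (Lam ℓ) E] (hE : Stab ℓ E)
    (t : X →ₗ[Lam ℓ] E) (hker : Finite (LinearMap.ker t))
    (hcoker : Finite (E ⧸ LinearMap.range t)) :
    ∃ u v : ℕ, ∀ᶠ n in atTop, (nab ℓ n X).index * ℓ ^ u = ℓ ^ v * (nab ℓ n E).index := by
  obtain ⟨c, hc⟩ := card_pow (ℓ := ℓ) (E ⧸ LinearMap.range t)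
  obtain ⟨k, hk⟩ := card_pow (ℓ := ℓ) (LinearMap.ker t)
  have hc' : (LinearMap.range t).toAddSubgroup.index = ℓ ^ c := hc
  -- `∇_N E ≤ range t`
  obtain ⟨N, hN⟩ : ∃ N, nab ℓ N E ≤ (LinearMap.range t).toAddSubgroup := by
    have : Module.Finite (Lam ℓ) (E ⧸ LinearMap.range t) := inferInstance
    obtain ⟨N, hN⟩ := (krull (ℓ := ℓ) (E ⧸ LinearMap.range t) Set.univ Set.finite_univ).exists
    refine ⟨N, fun x hx => ?_⟩
    obtain ⟨a, b, rfl⟩ := mem_nab.1 hx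
    have := hN (Submodule.Quotient.mk ((ℓ : Lam ℓ) ^ (N + 1) • a + omegaIw ℓ N • b)) trivial
      (mem_nab.2 ⟨Submodule.Quotient.mk a, Submodule.Quotient.mk b, rfl⟩)
    exact (Submodule.Quotient.mk_eq_zero _).1 this
  -- the stabilizing chain
  let S : ℕ → Submodule (Lam ℓ) (E × E) := fun n =>
    (LinearMap.range t).prod (LinearMap.range t) ⊔ LinearMap.ker (phi ℓ n E)
  obtain ⟨n₀, h0⟩ := eventually_atTop.1 (hE N)
  have hmono : Monotone fun e => S (n₀ + e) := by
    refine monotone_nat_of_le_succ fun e => sup_le le_sup_left ?_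
    rintro ⟨a, b⟩ hab
    rw [LinearMap.mem_ker, phi_apply] at hab
    obtain ⟨a', b', h1, h2, h3⟩ := h0 (n₀ + e) (by omega) a b hab
    have h4 : ((a, b) : E × E) = -(a' - a, b' - b) + (a', b') := by
      ext <;> simp
    rw [h4]
    refine Submodule.add_mem_sup (Submodule.neg_mem _ ⟨hN h2, hN h3⟩) ?_
    rw [LinearMap.mem_ker, phi_apply]
    exact h1
  have hnoeth : IsNoetherian (Lam ℓ) (E × E) := inferInstance
  obtain ⟨e₀, he⟩ := monotone_stabilizes_iff_noetherian.2 hnoeth ⟨_, hmono⟩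
  have hS : ∀ n ≥ n₀ + e₀, S n = S (n₀ + e₀) := by
    intro n hn
    obtain ⟨e, rfl⟩ := Nat.exists_eq_add_of_le hn
    have := he (e₀ + e) (by omega)
    rw [add_assoc]
    exact this.symm
  obtain ⟨d, -, hd⟩ : ∃ d ≤ c + c, (S (n₀ + e₀)).toAddSubgroup.index = ℓ ^ d := by
    refine (Nat.dvd_prime_pow (Fact.out : ℓ.Prime)).1 ?_
    rw [pow_add, ← hc', ← AddSubgroup.index_prod]
    refine AddSubgroup.index_dvd_of_le fun x hx => ?_
    exact Submodule.mem_sup_left (S := (LinearMap.range t).prod (LinearMap.range t)) hx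
  refine ⟨c, k + d, ?_⟩
  filter_upwards [eventually_ge_atTop (n₀ + e₀),
    krull (ℓ := ℓ) X (LinearMap.ker t : Set X) (Set.toFinite _)] with n hn hkr
  have i1 := AddSubgroup.index_map (nab ℓ n X) t.toAddMonoidHom
  have i2 := AddSubgroup.index_map
    ((LinearMap.range t).prod (LinearMap.range t)).toAddSubgroup (phi ℓ n E).toAddMonoidHom
  have e1 : (nab ℓ n X).map t.toAddMonoidHom =
      ((LinearMap.range t).prod (LinearMap.range t)).toAddSubgroup.map
        (phi ℓ n E).toAddMonoidHom := by
    ext x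
    rw [AddSubgroup.mem_map, AddSubgroup.mem_map]
    constructor
    · rintro ⟨y, hy, rfl⟩
      obtain ⟨a, b, rfl⟩ := mem_nab.1 hy
      refine ⟨(t a, t b), ⟨⟨a, rfl⟩, ⟨b, rfl⟩⟩, ?_⟩
      refine (phi_apply n E _).trans ?_
      change (ℓ : Lam ℓ) ^ (n + 1) • t a + omegaIw ℓ n • t b =
        t ((ℓ : Lam ℓ) ^ (n + 1) • a + omegaIw ℓ n • b)
      rw [map_add, map_smul, map_smul]
    · rintro ⟨⟨_, _⟩, ⟨⟨a, rfl⟩, ⟨b, rfl⟩⟩, rfl⟩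
      refine ⟨_, mem_nab.2 ⟨a, b, rfl⟩, ?_⟩
      refine Eq.trans ?_ (phi_apply n E _).symm
      change t ((ℓ : Lam ℓ) ^ (n + 1) • a + omegaIw ℓ n • b) =
        (ℓ : Lam ℓ) ^ (n + 1) • t a + omegaIw ℓ n • t b
      rw [map_add, map_smul, map_smul]
  have e2 : (phi ℓ n E).toAddMonoidHom.range = nab ℓ n E := by
    ext x
    rw [AddMonoidHom.mem_range, mem_nab]
    constructor
    · rintro ⟨y, rfl⟩; exact ⟨y.1, y.2, (phi_apply n E y).symm⟩
    · rintro ⟨a, b, rfl⟩; exact ⟨(a, b), phi_apply n E _⟩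
  have e3 : ((LinearMap.range t).prod (LinearMap.range t)).toAddSubgroup ⊔
      (phi ℓ n E).toAddMonoidHom.ker = (S (n₀ + e₀)).toAddSubgroup := by
    rw [← hS n hn, Submodule.sup_toAddSubgroup]
    rfl
  have e4 : t.toAddMonoidHom.range.index = ℓ ^ c := hc'
  have e5 : (nab ℓ n X).relIndex t.toAddMonoidHom.ker = ℓ ^ k := by
    rw [← AddSubgroup.inf_relIndex_right]
    have : nab ℓ n X ⊓ t.toAddMonoidHom.ker = ⊥ := by
      rw [eq_bot_iff]
      rintro x ⟨hx1, hx2⟩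
      exact hkr x hx2 hx1
    rw [this, AddSubgroup.relIndex_bot_left]
    exact hk
  have e6 := AddSubgroup.relIndex_mul_index
    (le_sup_left : nab ℓ n X ≤ nab ℓ n X ⊔ t.toAddMonoidHom.ker)
  rw [AddSubgroup.relIndex_sup_left, e5] at e6
  rw [e4] at i1
  rw [e3, e2, hd, ← e1, i1] at i2
  rw [← e6, mul_assoc, i2, pow_add, mul_assoc]

end IwPar

/-- Theorem of parameters: if the finitely generated `Λ`-module `X` is
pseudo-isomorphic to `Λ^ρ ⊕ (⊕_i Λ/f_iΛ) ⊕ (⊕_j Λ/ℓ^(m_j)Λ)`, with `μ = Σ_j m_j` and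
`λ = Σ_i deg f_i`, then there are `ν ∈ ℤ` and `n₀` such that for all `n ≥ n₀`, `X/∇_nX` is
finite of order `ℓ^(ρ(n+1)ℓ^n + μℓ^n + λn + ν)`. -/
theorem parameters_theorem (ℓ : ℕ) [Fact ℓ.Prime]
    (ρ : ℕ) (ι κ : Type) [Fintype ι] [Fintype κ]
    (f : ι → Polynomial ℤ_[ℓ]) (hf : ∀ i, IsDistinguishedAt ℓ (f i))
    (m : κ → ℕ) (hm : ∀ j, 0 < m j)
    (X : Type) [AddCommGroup X] [Module (Lam ℓ) X] [Module.Finite (Lam ℓ) X]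
    (t : X →ₗ[Lam ℓ] ElemMod ℓ ρ f m)
    (hker : Finite (LinearMap.ker t))
    (hcoker : Finite (ElemMod ℓ ρ f m ⧸ LinearMap.range t)) :
    ∃ (ν : ℤ) (n₀ : ℕ), ∀ n ≥ n₀,
      Finite (X ⧸ nablaN ℓ n (⊤ : Submodule (Lam ℓ) X)) ∧
      (Nat.card (X ⧸ nablaN ℓ n (⊤ : Submodule (Lam ℓ) X)) : ℚ) =
        (ℓ : ℚ) ^ (((ρ * (n + 1) * ℓ ^ n + (∑ j, m j) * ℓ ^ n +
          (∑ i, (f i).natDegree) * n : ℕ) : ℤ) + ν) := by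
  obtain ⟨u, v, h1⟩ := IwPar.index_elem ρ f hf m
  obtain ⟨u', v', h2⟩ := IwPar.assembly X (ElemMod ℓ ρ f m) (IwPar.stab_elem ρ f hf m) t
    hker hcoker
  obtain ⟨n₀, h0⟩ := Filter.eventually_atTop.1 (h1.and h2)
  refine ⟨(v : ℤ) + v' - u - u', n₀, fun n hn => ?_⟩
  obtain ⟨e1, e2⟩ := h0 n hn
  have hl : (ℓ : ℚ) ≠ 0 := Nat.cast_ne_zero.2 (Fact.out : ℓ.Prime).ne_zero
  rw [IwPar.card_eq]
  generalize ρ * (n + 1) * ℓ ^ n + (∑ j, m j) * ℓ ^ n + (∑ i, (f i).natDegree) * n = A at *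
  have e3 : (IwPar.nab ℓ n X).index * ℓ ^ (u + u') = ℓ ^ (A + v + v') := by
    rw [pow_add, mul_comm (ℓ ^ u), ← mul_assoc, e2, mul_assoc, e1, ← pow_add]
    congr 1; ring
  constructor
  · have hfi : (IwPar.nab ℓ n X).FiniteIndex := by
      refine ⟨fun h => ?_⟩
      rw [h, zero_mul] at e3
      exact pow_ne_zero _ (Fact.out : ℓ.Prime).ne_zero e3.symm
    exact AddSubgroup.finite_quotient_of_finiteIndex (H := IwPar.nab ℓ n X)
  · have e4 : ((IwPar.nab ℓ n X).index : ℚ) * (ℓ : ℚ) ^ ((u + u' : ℕ) : ℤ) =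
        (ℓ : ℚ) ^ ((A + v + v' : ℕ) : ℤ) := by
      rw [zpow_natCast, zpow_natCast]
      exact_mod_cast e3
    rw [eq_div_of_mul_eq (zpow_ne_zero _ hl) e4, ← zpow_sub₀ hl]
    congr 1
    push_cast; ring
end
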